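/- arXiv:1611.01655 — 3 statements merged into one kernel-verified Lean document; each statement's English description precedes it below -/
import Mathlib

section
/- For every probability distribution π on the linearly ordered set X_n = {x_1 ≺ x_2 ≺ ⋯ ≺ x_n}, there exists a decision tree valid for π, all of whose questions are comparison questions of the form {x_j : x_j ≺ x_i} ("is x ≺ x_i?") or equality questions of the form {x_i} ("is x = x_i?"), whose cost on π is at most H(π) + 1. -/
namespace TQ

/-- A decision tree: internal nodes are labeled by questions (subsets of `α`,
with the two children corresponding to Yes/No), leaves by elements of `α`. -/
inductive DTree (α : Type) where
  | leaf (x : α) : DTree α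
  | node (q : Finset α) (yes no : DTree α) : DTree α

namespace DTree

variable {α : Type} [DecidableEq α]

/-- The list of leaf labels of a decision tree. -/
def leaves : DTree α → List α
  | .leaf x => [x]
  | .node _ t f => leaves t ++ leaves f

/-- The set of questions appearing at internal nodes. -/
def questions : DTree α → Set (Finset α)
  | .leaf _ => ∅
  | .node q t f => insert q (questions t ∪ questions f)

/-- Follow the path of `x` (Yes-edge iff `x` belongs to the question);
returns `some d` iff the path ends at a leaf labeled `x`, at depth `d`. -/
def find? : DTree α → α → Option ℕ
  | .leaf y, x => if y = x then some 0 else none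
  | .node q t f, x => (if x ∈ q then find? t x else find? f x).map (· + 1)

/-- The depth of the leaf labeled `x` (junk value `0` if the path of `x`
does not end at a leaf labeled `x`). -/
def depth (T : DTree α) (x : α) : ℕ := (T.find? x).getD 0

end DTree

variable {α : Type} [Fintype α] [DecidableEq α]

/-- `μ` is a probability distribution on `α`. -/
def IsDistribution (μ : α → ℝ) : Prop := (∀ x, 0 ≤ μ x) ∧ ∑ x, μ x = 1

/-- `T` is valid for `μ`: its leaves are distinct, the set of leaf labels is the
support of `μ`, and for every `x` in the support the path of `x` ends at the
leaf labeled `x`. -/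
structure IsValid (T : DTree α) (μ : α → ℝ) : Prop where
  nodup : T.leaves.Nodup
  mem_leaves : ∀ x, x ∈ T.leaves ↔ μ x ≠ 0
  finds : ∀ x, μ x ≠ 0 → T.find? x = some (T.depth x)

/-- The cost of `T` on `μ`: the average depth `∑ x, μ(x) · T(x)`. -/
noncomputable def cost (T : DTree α) (μ : α → ℝ) : ℝ := ∑ x, μ x * (T.depth x : ℝ)

/-- All questions of `T` belong to `Q`. -/
def UsesQuestions (T : DTree α) (Q : Set (Finset α)) : Prop := T.questions ⊆ Q

/-- `Opt(μ)`: the optimal cost over all decision trees valid for `μ`. -/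
noncomputable def OptCost (μ : α → ℝ) : ℝ :=
  sInf { c | ∃ T : DTree α, IsValid T μ ∧ c = cost T μ }

/-- `c_Q(μ)`: the optimal cost over decision trees valid for `μ`
using only questions from `Q`. -/
noncomputable def cQ (Q : Set (Finset α)) (μ : α → ℝ) : ℝ :=
  sInf { c | ∃ T : DTree α, IsValid T μ ∧ UsesQuestions T Q ∧ c = cost T μ }

/-- The base-2 (Shannon) entropy of `μ`. (Note `Real.logb 2 0 = 0`.) -/
noncomputable def entropy (μ : α → ℝ) : ℝ := ∑ x, -(μ x * Real.logb 2 (μ x))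

/-- `Q` achieves prolixity `r`: for every distribution there is a valid tree using
only questions from `Q` of cost at most `Opt(μ) + r`. -/
def AchievesProlixity {n : ℕ} (Q : Finset (Finset (Fin n))) (r : ℝ) : Prop :=
  ∀ μ : Fin n → ℝ, IsDistribution μ →
    ∃ T : DTree (Fin n), IsValid T μ ∧ UsesQuestions T ↑Q ∧ cost T μ ≤ OptCost μ + r

/-- `Q` achieves redundancy `r`: for every distribution there is a valid tree using
only questions from `Q` of cost at most `H(μ) + r`. -/
def AchievesRedundancy {n : ℕ} (Q : Finset (Finset (Fin n))) (r : ℝ) : Prop :=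
  ∀ μ : Fin n → ℝ, IsDistribution μ →
    ∃ T : DTree (Fin n), IsValid T μ ∧ UsesQuestions T ↑Q ∧ cost T μ ≤ entropy μ + r

/-- `u_Opt(n,r)`: the minimum cardinality of a set of questions achieving prolixity `r`. -/
noncomputable def uOpt (n : ℕ) (r : ℝ) : ℕ :=
  sInf { k | ∃ Q : Finset (Finset (Fin n)), Q.card = k ∧ AchievesProlixity Q r }

/-- `u_H(n,r)`: the minimum cardinality of a set of questions achieving redundancy `r`. -/
noncomputable def uH (n : ℕ) (r : ℝ) : ℕ :=
  sInf { k | ∃ Q : Finset (Finset (Fin n)), Q.card = k ∧ AchievesRedundancy Q r }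

end TQ

namespace TQ

noncomputable def phi (q : ℝ) : ℝ := min (2*q^2) (min (1/2) (5/2*(1-q)))

noncomputable def h2 (s : ℝ) : ℝ := Real.binEntropy s / Real.log 2

theorem h2_def (s : ℝ) : h2 s = -(s * Real.logb 2 s) - (1-s) * Real.logb 2 (1-s) := by
  unfold h2 Real.logb
  rw [Real.binEntropy_eq_negMulLog_add_negMulLog_one_sub]
  unfold Real.negMulLog
  ring

theorem h2_concave {a b q : ℝ} (ha : 0 ≤ a) (hb : b ≤ 1) (hab : a < b) (haq : a ≤ q) (hqb : q ≤ b) :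
    (b - q) * h2 a + (q - a) * h2 b ≤ (b - a) * h2 q := by
  have hc := Real.strictConcave_binEntropy.concaveOn
  have hj := hc.2
  have h := @hj a ⟨ha, by linarith⟩ b ⟨by linarith, hb⟩
    ((b-q)/(b-a)) ((q-a)/(b-a)) (div_nonneg (by linarith) (by linarith))
    (div_nonneg (by linarith) (by linarith)) (by
      have : b - a ≠ 0 := by linarith
      field_simp; ring)
  have hba : 0 < b - a := by linarith
  simp only [smul_eq_mul] at h
  have e : (b - q) / (b - a) * a + (q - a) / (b - a) * b = q := by
    field_simp; ring
  rw [e] at h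
  have hl : 0 < Real.log 2 := Real.log_pos (by norm_num)
  have h3 : (b - q) * Real.binEntropy a + (q - a) * Real.binEntropy b ≤ (b - a) * Real.binEntropy q := by
    have := mul_le_mul_of_nonneg_left h hba.le
    calc _ = (b - a) * ((b - q) / (b - a) * Real.binEntropy a + (q - a) / (b - a) * Real.binEntropy b) := by
            field_simp
      _ ≤ _ := this
  unfold h2
  have := div_le_div_of_nonneg_right h3 hl.le
  calc _ = ((b - q) * Real.binEntropy a + (q - a) * Real.binEntropy b) / Real.log 2 := by ring
    _ ≤ _ := this
    _ = _ := by ring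

theorem h2_half : h2 (1/2) = 1 := by
  unfold h2
  have hl : 0 < Real.log 2 := Real.log_pos (by norm_num)
  rw [one_div, Real.binEntropy_two_inv]; field_simp

theorem h2_third : 8/9 ≤ h2 (1/3) := by
  have e : h2 (1/3) = Real.logb 2 3 - 2/3 := by
    rw [h2_def, show (1:ℝ) - 1/3 = 2/3 by norm_num, Real.logb_div (by norm_num) (by norm_num),
      Real.logb_div (by norm_num) (by norm_num), Real.logb_one, Real.logb_self_eq_one (by norm_num)]
    ring
  have : (14:ℝ) ≤ 9 * Real.logb 2 3 := by
    have : (9:ℝ) * Real.logb 2 3 = Real.logb 2 (3^9) := by rw [Real.logb_pow]; norm_num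
    rw [this, Real.le_logb_iff_rpow_le (by norm_num) (by norm_num)]
    norm_num
  linarith

theorem h2_45 : 7/10 ≤ h2 (4/5) := by
  have e : h2 (4/5) = Real.logb 2 5 - 8/5 := by
    rw [h2_def, show (1:ℝ) - 4/5 = 1/5 by norm_num, Real.logb_div (by norm_num) (by norm_num),
      Real.logb_div (by norm_num) (by norm_num), Real.logb_one, show (4:ℝ) = 2^2 by norm_num,
      Real.logb_pow, Real.logb_self_eq_one (by norm_num)]
    push_cast
    ring
  have : (23:ℝ) ≤ 10 * Real.logb 2 5 := by
    have : (10:ℝ) * Real.logb 2 5 = Real.logb 2 (5^10) := by rw [Real.logb_pow]; norm_num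
    rw [this, Real.le_logb_iff_rpow_le (by norm_num) (by norm_num)]
    norm_num
  linarith

theorem h2_one : h2 1 = 0 := by simp [h2]

theorem eq_ineq {q : ℝ} (h1 : 1/3 ≤ q) (h2' : q ≤ 1) : phi q ≤ h2 q + q - 1 := by
  unfold phi
  rcases le_total q (1/2) with h | h
  · refine (min_le_left _ _).trans ?_
    have := h2_concave (a := 1/3) (b := 1/2) (q := q) (by norm_num) (by norm_num) (by norm_num) h1 h
    rw [h2_half] at this
    have := h2_third
    nlinarith
  · refine (min_le_right _ _).trans ?_
    rcases le_total q (4/5) with h' | h'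
    · refine (min_le_left _ _).trans ?_
      have := h2_concave (a := 1/2) (b := 4/5) (q := q) (by norm_num) (by norm_num) (by norm_num) h h'
      rw [h2_half] at this
      have := h2_45
      nlinarith
    · refine (min_le_right _ _).trans ?_
      have := h2_concave (a := 4/5) (b := 1) (q := q) (by norm_num) (by norm_num) (by norm_num) h' h2'
      rw [h2_one] at this
      have := h2_45
      nlinarith

theorem phi_nonneg {q : ℝ} (h : q ≤ 1) : 0 ≤ phi q := by
  unfold phi
  refine le_min (by positivity) (le_min (by norm_num) (by linarith))

theorem loss {x : ℝ} (h0 : 0 ≤ x) (h1 : x ≤ 1/3) : 1 - h2 ((1+x)/2) ≤ x^2 := by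
  have e : 1 - h2 ((1+x)/2) = ((1+x) * Real.log (1+x) + (1-x) * Real.log (1-x)) / (2 * Real.log 2) := by
    have hl : 0 < Real.log 2 := Real.log_pos (by norm_num)
    rw [h2_def, show (1:ℝ) - (1+x)/2 = (1-x)/2 by ring, Real.logb, Real.logb,
      Real.log_div (by linarith) (by norm_num), Real.log_div (by linarith) (by norm_num)]
    field_simp
    ring
  have a1 := Real.abs_log_sub_add_sum_range_le (x := x) (by rw [abs_of_nonneg h0]; linarith) 4
  have a2 := Real.abs_log_sub_add_sum_range_le (x := -x) (by rw [abs_neg, abs_of_nonneg h0]; linarith) 4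
  rw [abs_neg] at a2
  rw [abs_of_nonneg h0] at a1 a2
  have b : x^(4+1)/(1-x) ≤ 3/2 * x^5 := by
    rw [div_le_iff₀ (by linarith)]
    have : 0 ≤ x^5 := by positivity
    nlinarith
  have c1 := (abs_le.1 (a1.trans b)).2
  have c2 := (abs_le.1 (a2.trans b)).2
  simp only [Finset.sum_range_succ, Finset.sum_range_zero, sub_neg_eq_add] at c1 c2
  norm_num at c1 c2
  rw [e, div_le_iff₀ (by have := Real.log_pos (show (1:ℝ) < 2 by norm_num); linarith)]
  have hl := Real.log_two_gt_d9
  have d1 := mul_le_mul_of_nonneg_left c1 (show 0 ≤ 1 - x by linarith)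
  have d2 := mul_le_mul_of_nonneg_left c2 (show 0 ≤ 1 + x by linarith)
  have hx2 : 0 ≤ x^2 := by positivity
  have k2 : x^2 ≤ 1/9 := by nlinarith
  have k3 : x^3 ≤ 1/27 := by nlinarith
  have k4 : x^4 ≤ x^2*(1/9) := by nlinarith
  have k5 : x^5 ≤ x^2*(1/27) := by nlinarith
  have k4' : 0 ≤ x^4 := by positivity
  have k5' : 0 ≤ x^5 := by positivity
  nlinarith

/-- the numeric inequality for comparison splits -/
theorem split_ineq {x p a b : ℝ} (hx : 0 ≤ x) (hxa : x ≤ a) (ha : a ≤ p) (hb : b ≤ p)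
    (hp : p < 1/3) (hb0 : 0 ≤ b) (hm : p = a ∨ p = b) :
    phi p + 1 - h2 ((1+x)/2) ≤ (1+x)/2 * phi (a/((1+x)/2)) + (1-x)/2 * phi (b/((1-x)/2)) := by
  have hl := loss hx (by linarith)
  have hphi : phi p ≤ 2 * p^2 := min_le_left _ _
  have key : ∀ s a : ℝ, 0 < s → s * phi (a/s) = min (2*a^2/s) (min (s/2) (5/2*(s-a))) := by
    intro s a hs
    unfold phi
    rw [mul_min_of_nonneg _ _ hs.le, mul_min_of_nonneg _ _ hs.le]
    congr 1
    · field_simp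
    · congr 1
      · ring
      · field_simp
  have hx3 : x < 1/3 := by linarith
  have hbnd : 0 ≤ (1-x)/2 * phi (b/((1-x)/2)) := by
    apply mul_nonneg (by linarith) (phi_nonneg _)
    rw [div_le_one (by linarith)]; linarith
  rcases hm with rfl | rfl
  · have : 2*p^2 + x^2 ≤ (1+x)/2 * phi (p/((1+x)/2)) := by
      rw [key _ _ (by linarith)]
      refine le_min ?_ (le_min ?_ ?_)
      · rw [le_div_iff₀ (by linarith)]
        nlinarith [mul_nonneg hx hx, mul_self_nonneg p]
      · nlinarith
      · nlinarith
    linarith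
  · have hA : 4*x^2/(1+x) ≤ (1+x)/2 * phi (a/((1+x)/2)) := by
      rw [key _ _ (by linarith)]
      refine le_min ?_ (le_min ?_ ?_)
      · rw [div_le_div_iff₀ (by linarith) (by linarith)]
        have : x^2 ≤ a^2 := by nlinarith
        nlinarith
      · rw [div_le_iff₀ (by linarith)]
        nlinarith
      · rw [div_le_iff₀ (by linarith)]
        nlinarith
    have hp2 : p^2 ≤ 1/9 := by nlinarith
    have hA3 : 3*x^2 ≤ 4*x^2/(1+x) := by
      rw [le_div_iff₀ (by linarith)]; nlinarith [mul_nonneg hx hx]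
    have hB : 2*p^2 + x^2 - 4*x^2/(1+x) ≤ (1-x)/2 * phi (p/((1-x)/2)) := by
      rw [key _ _ (by linarith)]
      refine le_min ?_ (le_min ?_ ?_)
      · have : 2*p^2 ≤ 2*p^2/((1-x)/2) := by
          rw [le_div_iff₀ (by linarith)]; nlinarith [mul_self_nonneg p]
        nlinarith
      · nlinarith [sq_nonneg (x - 1/16)]
      · have : 2/9 + x^2 - (5/2*((1-x)/2 - 1/3)) ≤ 4*x^2/(1+x) := by
          rw [le_div_iff₀ (by linarith)]
          have : 0 ≤ x^2 - 17/12*x + 7/12 := by nlinarith [sq_nonneg (x - 17/24)]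
          nlinarith [mul_nonneg (show 0 ≤ 1/3 - x by linarith) this]
        nlinarith
    linarith
end TQ

namespace TQ

theorem ent_id {a b : ℝ} (ha : 0 < a) (hb : 0 < b) :
    a * Real.logb 2 a + b * Real.logb 2 b
      = (a+b) * Real.logb 2 (a+b) - (a+b) * h2 (a/(a+b)) := by
  have hW : 0 < a + b := by linarith
  rw [h2_def, show 1 - a/(a+b) = b/(a+b) by field_simp; ring,
    Real.logb_div ha.ne' hW.ne', Real.logb_div hb.ne' hW.ne']
  field_simp
  ring

theorem combine_split {a b pA pB p : ℝ} (hb : 0 < b) (hab : b ≤ a) (hw : a - b ≤ pA)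
    (hA : pA ≤ p) (hB : pB ≤ p) (hB0 : 0 ≤ pB) (hp : p < (a+b)/3) (hm : p = pA ∨ p = pB) :
    (a+b) + (a * Real.logb 2 a + a * (1 - phi (pA/a))) + (b * Real.logb 2 b + b * (1 - phi (pB/b)))
      ≤ (a+b) * Real.logb 2 (a+b) + (a+b) * (1 - phi (p/(a+b))) := by
  have ha : 0 < a := by linarith
  have hW : 0 < a + b := by linarith
  have h := split_ineq (x := (a-b)/(a+b)) (p := p/(a+b)) (a := pA/(a+b)) (b := pB/(a+b))
    (div_nonneg (by linarith) hW.le) (div_le_div_of_nonneg_right hw hW.le)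
    (div_le_div_of_nonneg_right hA hW.le) (div_le_div_of_nonneg_right hB hW.le)
    (by rw [div_lt_iff₀ hW]; linarith) (div_nonneg hB0 hW.le)
    (by rcases hm with h | h <;> simp [h])
  have e1 : (1 + (a-b)/(a+b))/2 = a/(a+b) := by field_simp; ring
  have e2 : (1 - (a-b)/(a+b))/2 = b/(a+b) := by field_simp; ring
  rw [e1, e2, div_div_div_cancel_right₀ hW.ne', div_div_div_cancel_right₀ hW.ne'] at h
  have h' := mul_le_mul_of_nonneg_left h hW.le
  have e3 : (a+b) * (a/(a+b) * phi (pA/a) + b/(a+b) * phi (pB/b)) = a * phi (pA/a) + b * phi (pB/b) := by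
    field_simp
  rw [e3] at h'
  have := ent_id ha hb
  linarith

theorem combine_eq {a b q : ℝ} (ha : 0 < a) (hb : 0 < b) (h3 : (a+b)/3 ≤ a) (hq : q ≤ b) :
    (a+b) + a * Real.logb 2 a + (b * Real.logb 2 b + b * (1 - phi (q/b)))
      ≤ (a+b) * Real.logb 2 (a+b) + (a+b) * (1 - phi (a/(a+b))) := by
  have hW : 0 < a + b := by linarith
  have h := eq_ineq (q := a/(a+b)) (by rw [le_div_iff₀ hW]; linarith) (by rw [div_le_one hW]; linarith)
  have h' := mul_le_mul_of_nonneg_left h hW.le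
  have e3 : (a+b) * (h2 (a/(a+b)) + a/(a+b) - 1) = (a+b) * h2 (a/(a+b)) - b := by
    field_simp; ring
  rw [e3] at h'
  have := ent_id ha hb
  have : 0 ≤ b * phi (q/b) := mul_nonneg hb.le (phi_nonneg (by rw [div_le_one hb]; exact hq))
  linarith

variable {n : ℕ}

structure Good (T : DTree (Fin n)) (S : Finset (Fin n)) : Prop where
  nodup : T.leaves.Nodup
  mem : ∀ x, x ∈ T.leaves ↔ x ∈ S
  finds : ∀ x ∈ S, T.find? x = some (T.depth x)
  qs : ∀ q ∈ T.questions, (∃ i : Fin n, q = Finset.Iio i) ∨ (∃ i : Fin n, q = {i})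

noncomputable def EE (π : Fin n → ℝ) (T : DTree (Fin n)) (S : Finset (Fin n)) : ℝ :=
  ∑ x ∈ S, π x * ((T.depth x : ℝ) + Real.logb 2 (π x))

theorem Good.leaf (x : Fin n) : Good (.leaf x) {x} := by
  constructor <;> simp [DTree.leaves, DTree.find?, DTree.depth, DTree.questions]

theorem depth_yes {q : Finset (Fin n)} {T1 T2 : DTree (Fin n)} {S : Finset (Fin n)} (h : Good T1 S)
    {x : Fin n} (hx : x ∈ S) (hq : x ∈ q) :
    (DTree.node q T1 T2).find? x = some (T1.depth x + 1) := by
  simp [DTree.find?, hq, h.finds x hx]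

theorem depth_no {q : Finset (Fin n)} {T1 T2 : DTree (Fin n)} {S : Finset (Fin n)} (h : Good T2 S)
    {x : Fin n} (hx : x ∈ S) (hq : x ∉ q) :
    (DTree.node q T1 T2).find? x = some (T2.depth x + 1) := by
  simp [DTree.find?, hq, h.finds x hx]

theorem Good.node {q S : Finset (Fin n)} {T1 T2 : DTree (Fin n)}
    (h1 : Good T1 (S.filter (· ∈ q))) (h2 : Good T2 (S.filter (· ∉ q)))
    (hq : (∃ i : Fin n, q = Finset.Iio i) ∨ (∃ i : Fin n, q = {i})) :
    Good (.node q T1 T2) S where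
  nodup := by
    rw [DTree.leaves, List.nodup_append]
    refine ⟨h1.nodup, h2.nodup, ?_⟩
    intro a ha b hb hab
    rw [h1.mem, Finset.mem_filter] at ha
    rw [h2.mem, Finset.mem_filter] at hb
    subst hab
    exact hb.2 ha.2
  mem := by
    intro x
    rw [DTree.leaves, List.mem_append, h1.mem, h2.mem, Finset.mem_filter, Finset.mem_filter]
    tauto
  finds := by
    intro x hx
    by_cases h : x ∈ q
    · have := depth_yes (T2 := T2) h1 (Finset.mem_filter.2 ⟨hx, h⟩) h
      rw [DTree.depth, this]; rfl
    · have := depth_no (T1 := T1) h2 (Finset.mem_filter.2 ⟨hx, h⟩) h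
      rw [DTree.depth, this]; rfl
  qs := by
    intro r hr
    simp only [DTree.questions, Set.mem_insert_iff, Set.mem_union] at hr
    rcases hr with rfl | hr | hr
    · exact hq
    · exact h1.qs r hr
    · exact h2.qs r hr

theorem EE_node (π : Fin n → ℝ) {q S : Finset (Fin n)} {T1 T2 : DTree (Fin n)}
    (h1 : Good T1 (S.filter (· ∈ q))) (h2 : Good T2 (S.filter (· ∉ q))) :
    EE π (.node q T1 T2) S = (∑ x ∈ S.filter (· ∈ q), π x + ∑ x ∈ S.filter (· ∉ q), π x) +
      EE π T1 (S.filter (· ∈ q)) + EE π T2 (S.filter (· ∉ q)) := by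
  have e1 : EE π (.node q T1 T2) (S.filter (· ∈ q)) =
      ∑ x ∈ S.filter (· ∈ q), π x + EE π T1 (S.filter (· ∈ q)) := by
    unfold EE
    rw [← Finset.sum_add_distrib]
    refine Finset.sum_congr rfl fun x hx => ?_
    rw [DTree.depth, depth_yes h1 hx (Finset.mem_filter.1 hx).2]
    simp only [Option.getD_some]; push_cast; ring
  have e2 : EE π (.node q T1 T2) (S.filter (· ∉ q)) =
      ∑ x ∈ S.filter (· ∉ q), π x + EE π T2 (S.filter (· ∉ q)) := by
    unfold EE
    rw [← Finset.sum_add_distrib]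
    refine Finset.sum_congr rfl fun x hx => ?_
    rw [DTree.depth, depth_no h2 hx (Finset.mem_filter.1 hx).2]
    simp only [Option.getD_some]; push_cast; ring
  have e3 : EE π (.node q T1 T2) S = EE π (.node q T1 T2) (S.filter (· ∈ q)) +
      EE π (.node q T1 T2) (S.filter (· ∉ q)) := by
    unfold EE
    exact (Finset.sum_filter_add_sum_filter_not _ _ _).symm
  rw [e3, e1, e2]; ring

/-- existence of a balanced comparison split -/
theorem exists_split (π : Fin n → ℝ) (S : Finset (Fin n)) (hS : S.Nonempty) (hpos : ∀ x ∈ S, 0 < π x) :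
    ∃ m ∈ S, ∃ i : Fin n,
      (m ∉ Finset.Iio i ∧ ∑ x ∈ S.filter (· ∈ Finset.Iio i), π x ≤ ∑ x ∈ S.filter (· ∉ Finset.Iio i), π x ∧
        ∑ x ∈ S.filter (· ∉ Finset.Iio i), π x - ∑ x ∈ S.filter (· ∈ Finset.Iio i), π x ≤ π m) ∨
      (m ∈ Finset.Iio i ∧ ∑ x ∈ S.filter (· ∉ Finset.Iio i), π x ≤ ∑ x ∈ S.filter (· ∈ Finset.Iio i), π x ∧
        ∑ x ∈ S.filter (· ∈ Finset.Iio i), π x - ∑ x ∈ S.filter (· ∉ Finset.Iio i), π x ≤ π m) := by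
  -- the last element m of S such that the mass strictly before m is at most the mass from m on
  have hne : (S.filter fun j => ∑ x ∈ S.filter (· ∈ Finset.Iio j), π x ≤
      ∑ x ∈ S.filter (· ∉ Finset.Iio j), π x).Nonempty := by
    refine ⟨S.min' hS, Finset.mem_filter.2 ⟨S.min'_mem hS, ?_⟩⟩
    have : S.filter (· ∈ Finset.Iio (S.min' hS)) = ∅ := by
      rw [Finset.filter_eq_empty_iff]
      intro x hx
      rw [Finset.mem_Iio, not_lt]
      exact S.min'_le x hx
    rw [this, Finset.sum_empty]
    exact Finset.sum_nonneg fun x hx => (hpos x (Finset.mem_filter.1 hx).1).le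
  set F := S.filter fun j => ∑ x ∈ S.filter (· ∈ Finset.Iio j), π x ≤
      ∑ x ∈ S.filter (· ∉ Finset.Iio j), π x with hF
  have hmF := F.max'_mem hne
  set m := F.max' hne with hm
  obtain ⟨hmS, hmle⟩ := Finset.mem_filter.1 hmF
  refine ⟨m, hmS, ?_⟩
  by_cases hc : ∑ x ∈ S.filter (· ∉ Finset.Iio m), π x - ∑ x ∈ S.filter (· ∈ Finset.Iio m), π x ≤ π m
  · exact ⟨m, Or.inl ⟨by simp, hmle, hc⟩⟩
  · push Not at hc
    have hsplit : S.filter (· ∉ Finset.Iio m) = insert m (S.filter (m < ·)) := by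
      ext x
      simp only [Finset.mem_filter, Finset.mem_insert, Finset.mem_Iio, not_lt]
      constructor
      · rintro ⟨h1, h2⟩
        rcases h2.eq_or_lt with h | h
        · exact Or.inl h.symm
        · exact Or.inr ⟨h1, h⟩
      · rintro (h | ⟨h1, h2⟩)
        · subst h; exact ⟨hmS, le_rfl⟩
        · exact ⟨h1, h2.le⟩
    have hs : ∑ x ∈ S.filter (· ∉ Finset.Iio m), π x = π m + ∑ x ∈ S.filter (m < ·), π x := by
      rw [hsplit, Finset.sum_insert (by simp)]
    have hL : 0 ≤ ∑ x ∈ S.filter (· ∈ Finset.Iio m), π x :=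
      Finset.sum_nonneg fun x hx => (hpos x (Finset.mem_filter.1 hx).1).le
    have hRne : (S.filter (m < ·)).Nonempty := by
      by_contra h
      rw [Finset.not_nonempty_iff_eq_empty] at h
      rw [hs, h, Finset.sum_empty] at hc
      linarith
    set i := (S.filter (m < ·)).min' hRne with hi
    have hiR := (S.filter (m < ·)).min'_mem hRne
    rw [← hi] at hiR
    obtain ⟨hiS, hmi⟩ := Finset.mem_filter.1 hiR
    have hB : S.filter (· ∉ Finset.Iio i) = S.filter (m < ·) := by
      ext x
      simp only [Finset.mem_filter, Finset.mem_Iio, not_lt]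
      constructor
      · rintro ⟨h1, h2⟩; exact ⟨h1, hmi.trans_le h2⟩
      · rintro ⟨h1, h2⟩; exact ⟨h1, Finset.min'_le _ _ (Finset.mem_filter.2 ⟨h1, h2⟩)⟩
    have t1 := Finset.sum_filter_add_sum_filter_not S (· ∈ Finset.Iio i) π
    have t2 := Finset.sum_filter_add_sum_filter_not S (· ∈ Finset.Iio m) π
    have hnot : ¬ (∑ x ∈ S.filter (· ∈ Finset.Iio i), π x ≤ ∑ x ∈ S.filter (· ∉ Finset.Iio i), π x) := by
      intro h
      have : i ≤ m := F.le_max' i (Finset.mem_filter.2 ⟨hiS, h⟩)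
      exact absurd hmi (not_lt.2 this)
    push Not at hnot
    refine ⟨i, Or.inr ⟨by simpa using hmi, hnot.le, ?_⟩⟩
    rw [hB] at t1 ⊢
    linarith

theorem main_ind (π : Fin n → ℝ) : ∀ (k : ℕ) (S : Finset (Fin n)), S.card = k → S.Nonempty →
    (∀ x ∈ S, 0 < π x) → ∃ T : DTree (Fin n), ∃ m ∈ S, (∀ x ∈ S, π x ≤ π m) ∧ Good T S ∧
      EE π T S ≤ (∑ x ∈ S, π x) * Real.logb 2 (∑ x ∈ S, π x) +
        (∑ x ∈ S, π x) * (1 - phi (π m / ∑ x ∈ S, π x)) := by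
  intro k
  induction k using Nat.strong_induction_on with
  | _ k ih =>
  intro S hk hS hpos
  obtain ⟨m, hmS, hmax⟩ := S.exists_max_image π hS
  by_cases h3 : (∑ x ∈ S, π x) / 3 ≤ π m
  · by_cases hs : S = {m}
    · subst hs
      refine ⟨.leaf m, m, hmS, hmax, Good.leaf m, ?_⟩
      have hm0 := hpos m hmS
      have : phi 1 = 0 := by norm_num [phi]
      simp [EE, DTree.depth, DTree.find?, div_self hm0.ne', this, hm0.le]
    · have f1 : S.filter (· ∈ ({m} : Finset (Fin n))) = {m} := by
        ext x; simp only [Finset.mem_filter, Finset.mem_singleton]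
        constructor
        · exact fun h => h.2
        · rintro rfl; exact ⟨hmS, rfl⟩
      have f2 : S.filter (· ∉ ({m} : Finset (Fin n))) = S.erase m := by
        ext x; simp [and_comm]
      have hne : (S.erase m).Nonempty := by
        rw [Finset.nonempty_iff_ne_empty]
        intro h
        rw [Finset.erase_eq_empty_iff] at h
        rcases h with h | h
        · exact hS.ne_empty h
        · exact hs h
      obtain ⟨T, m', hm'S, hmax', hg, hE⟩ := ih (S.erase m).card
        (hk ▸ Finset.card_erase_lt_of_mem hmS) (S.erase m) rfl hne
        (fun x hx => hpos x (Finset.mem_of_mem_erase hx))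
      have g1 : Good (.leaf m) (S.filter (· ∈ ({m} : Finset (Fin n)))) := by
        rw [f1]; exact Good.leaf m
      have g2 : Good T (S.filter (· ∉ ({m} : Finset (Fin n)))) := by
        rw [f2]; exact hg
      refine ⟨.node {m} (.leaf m) T, m, hmS, hmax, Good.node g1 g2 (Or.inr ⟨m, rfl⟩), ?_⟩
      rw [EE_node π g1 g2, f1, f2, Finset.sum_singleton]
      have hW : ∑ x ∈ S, π x = π m + ∑ x ∈ S.erase m, π x := (Finset.add_sum_erase S π hmS).symm
      have e0 : EE π (.leaf m) {m} = π m * Real.logb 2 (π m) := by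
        simp [EE, DTree.depth, DTree.find?]
      have hb : 0 < ∑ x ∈ S.erase m, π x :=
        Finset.sum_pos (fun x hx => hpos x (Finset.mem_of_mem_erase hx)) hne
      have hq : π m' ≤ ∑ x ∈ S.erase m, π x :=
        Finset.single_le_sum (f := π) (fun x hx => (hpos x (Finset.mem_of_mem_erase hx)).le) hm'S
      rw [hW] at h3 ⊢
      have := combine_eq (hpos m hmS) hb h3 hq
      linarith
  · push Not at h3
    obtain ⟨w, hwS, i, hsp⟩ := exists_split π S hS hpos
    set A := S.filter (· ∈ Finset.Iio i) with hA
    set B := S.filter (· ∉ Finset.Iio i) with hB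
    have t := Finset.sum_filter_add_sum_filter_not S (· ∈ Finset.Iio i) π
    rw [← hA, ← hB] at t
    have hAS : ∀ x ∈ A, x ∈ S := fun x hx => (Finset.mem_filter.1 hx).1
    have hBS : ∀ x ∈ B, x ∈ S := fun x hx => (Finset.mem_filter.1 hx).1
    have hwm := hmax w hwS
    have hm0 := hpos m hmS
    have hApos : 0 < ∑ x ∈ A, π x := by rcases hsp with h | h <;> linarith
    have hBpos : 0 < ∑ x ∈ B, π x := by rcases hsp with h | h <;> linarith
    have hAne : A.Nonempty := by
      rw [Finset.nonempty_iff_ne_empty]; intro h; rw [h] at hApos; simp at hApos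
    have hBne : B.Nonempty := by
      rw [Finset.nonempty_iff_ne_empty]; intro h; rw [h] at hBpos; simp at hBpos
    have hc : A.card + B.card = S.card := Finset.card_filter_add_card_filter_not _
    have := hAne.card_pos
    have := hBne.card_pos
    obtain ⟨T1, m1, hm1, hmax1, g1, E1⟩ := ih A.card (by omega) A rfl hAne (fun x hx => hpos x (hAS x hx))
    obtain ⟨T2, m2, hm2, hmax2, g2, E2⟩ := ih B.card (by omega) B rfl hBne (fun x hx => hpos x (hBS x hx))
    refine ⟨.node (Finset.Iio i) T1 T2, m, hmS, hmax, Good.node g1 g2 (Or.inl ⟨i, rfl⟩), ?_⟩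
    rw [EE_node π g1 g2, ← hA, ← hB]
    have hm1' := hmax m1 (hAS _ hm1)
    have hm2' := hmax m2 (hBS _ hm2)
    have hor : π m = π m1 ∨ π m = π m2 := by
      by_cases h : m ∈ Finset.Iio i
      · exact Or.inl (le_antisymm (hmax1 m (Finset.mem_filter.2 ⟨hmS, h⟩)) hm1')
      · exact Or.inr (le_antisymm (hmax2 m (Finset.mem_filter.2 ⟨hmS, h⟩)) hm2')
    rw [← t] at h3 ⊢
    rcases hsp with ⟨h, hle, hd⟩ | ⟨h, hle, hd⟩
    · have hw := hmax2 w (Finset.mem_filter.2 ⟨hwS, h⟩)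
      have := combine_split hApos hle (hd.trans hw) hm2' hm1' (hpos _ (hAS _ hm1)).le
        (by linarith) hor.symm
      rw [add_comm (∑ x ∈ B, π x)] at this
      linarith
    · have hw := hmax1 w (Finset.mem_filter.2 ⟨hwS, h⟩)
      have := combine_split hBpos hle (hd.trans hw) hm1' hm2' (hpos _ (hBS _ hm2)).le
        (by linarith) hor
      linarith

end TQ

open TQ in
/-- For every distribution `π` on the linearly ordered set `Fin n`, there is a valid
decision tree all of whose questions are comparison questions ("is x ≺ x_i?") or
equality questions ("is x = x_i?"), of cost at most `H(π) + 1`. -/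
theorem comparison_equality_redundancy_one (n : ℕ) (π : Fin n → ℝ)
    (hπ : IsDistribution π) :
    ∃ T : DTree (Fin n), IsValid T π ∧
      (∀ q ∈ T.questions,
        (∃ i : Fin n, q = Finset.Iio i) ∨ (∃ i : Fin n, q = {i})) ∧
      cost T π ≤ entropy π + 1 := by
  obtain ⟨h0, h1⟩ := hπ
  set S := Finset.univ.filter (fun x => π x ≠ 0) with hS
  have hsum : ∑ x ∈ S, π x = 1 := by
    rw [hS, Finset.sum_filter_ne_zero, h1]
  have hne : S.Nonempty := by
    rw [Finset.nonempty_iff_ne_empty]; intro h; rw [h] at hsum; simp at hsum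
  have hpos : ∀ x ∈ S, 0 < π x := fun x hx =>
    lt_of_le_of_ne (h0 x) (Ne.symm (Finset.mem_filter.1 hx).2)
  obtain ⟨T, m, hm, hmax, hg, hE⟩ := main_ind π S.card S rfl hne hpos
  refine ⟨T, ⟨hg.nodup, fun x => by rw [hg.mem]; simp [hS],
    fun x hx => hg.finds x (by simpa [hS] using hx)⟩, hg.qs, ?_⟩
  have hle : π m ≤ 1 := hsum ▸ Finset.single_le_sum (f := π) (fun x hx => (hpos x hx).le) hm
  rw [hsum, Real.logb_one, div_one] at hE
  have hp := phi_nonneg hle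
  have e : cost T π - entropy π = EE π T S := by
    unfold cost entropy EE
    rw [← Finset.sum_sub_distrib, hS, Finset.sum_filter]
    refine Finset.sum_congr rfl fun x _ => ?_
    by_cases h : π x = 0
    · simp [h]
    · rw [if_pos h]; ring
  linarith
end

section
/- Let Y be a finite linearly ordered set, let k ≥ 1, and let Z = Y^k be the set of vectors of length k over Y. For every probability distribution π on Z there exists a decision tree valid for π, all of whose questions are entry-wise comparison questions {z ∈ Z : z_i ≺ y} ("is z_i ≺ y?") or entry-wise equality questions {z ∈ Z : z_i = y} ("is z_i = y?") for some coordinate i ∈ [k] and element y ∈ Y, whose cost on π is at most H(π) + k. -/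
namespace TQ

noncomputable def hh (a : ℝ) : ℝ := Real.binEntropy a / Real.log 2
noncomputable def FF (p : ℝ) : ℝ := min (13/7 * p^2) (2/5)
noncomputable def eta (x : ℝ) : ℝ := x * Real.logb 2 x

lemma eta_split (a V : ℝ) (ha : 0 < a) (ha1 : a < 1) (hV : 0 < V) :
    eta (a*V) + eta ((1-a)*V) = eta V - V * hh a := by
  have h2 : Real.log 2 ≠ 0 := (Real.log_pos (by norm_num)).ne'
  have : 0 < 1 - a := by linarith
  simp only [eta, hh, Real.logb, Real.binEntropy, Real.log_inv]
  rw [Real.log_mul ha.ne' hV.ne', Real.log_mul this.ne' hV.ne']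
  field_simp
  ring

lemma FF_nonneg (p : ℝ) : 0 ≤ FF p := le_min (by positivity) (by norm_num)

lemma FF_mono {p q : ℝ} (hp : 0 ≤ p) (h : p ≤ q) : FF p ≤ FF q := by
  unfold FF; gcongr

lemma n1 (a : ℝ) (h1 : 1/2 ≤ a) (h2 : a ≤ 13/20) : 1 - (2*a-1)^2 ≤ hh a := by
  obtain ⟨u, rfl⟩ : ∃ u, a = (1+u)/2 := ⟨2*a-1, by ring⟩
  have hu0 : 0 ≤ u := by linarith
  have hu1 : u ≤ 3/10 := by linarith
  have hl := Real.log_two_gt_d9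
  have A := Real.abs_log_sub_add_sum_range_le (x := u) (by rw [abs_of_nonneg hu0]; linarith) 3
  have B := Real.abs_log_sub_add_sum_range_le (x := -u) (by rw [abs_neg, abs_of_nonneg hu0]; linarith) 3
  rw [abs_neg] at B
  rw [abs_of_nonneg hu0] at A B
  have C : u^(3+1)/(1-u) ≤ u^4 * (10/7) := by
    rw [div_le_iff₀ (by linarith)]
    nlinarith [pow_nonneg hu0 4]
  have A1 := (abs_le.1 (A.trans C)).2
  have B1 := (abs_le.1 (B.trans C)).2
  simp only [Finset.sum_range_succ, Finset.sum_range_zero] at A1 B1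
  norm_num at A1 B1
  have hh1 : Real.log ((1+u)/2) = Real.log (1+u) - Real.log 2 := Real.log_div (by linarith) (by norm_num)
  have hh2 : Real.log (1-(1+u)/2) = Real.log (1-u) - Real.log 2 := by
    rw [← Real.log_div (by linarith) (by norm_num)]; congr 1; ring
  unfold hh
  rw [le_div_iff₀ (by linarith)]
  simp only [Real.binEntropy, Real.log_inv]
  rw [hh1, hh2]
  have P1 : (1+u) * Real.log (1+u) ≤ (1+u) * (u - u^2/2+u^3/3+u^4*(10/7)) := by
    apply mul_le_mul_of_nonneg_left _ (by linarith); nlinarith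
  have P2 : (1-u) * Real.log (1-u) ≤ (1-u) * (-u - u^2/2-u^3/3+u^4*(10/7)) := by
    apply mul_le_mul_of_nonneg_left _ (by linarith); nlinarith
  have P3 : u^4 ≤ u^2 * (9/100) := by
    have : u^2 ≤ 9/100 := by nlinarith
    nlinarith [sq_nonneg u]
  have P4 : u^2 * 0.69 ≤ u^2 * Real.log 2 := mul_le_mul_of_nonneg_left (by linarith) (sq_nonneg u)
  nlinarith

lemma conc {a b x : ℝ} {A B : ℝ} (ha : 0 ≤ a) (hb : b ≤ 1) (hab : a < b) (hx : a ≤ x) (hx' : x ≤ b)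
   (hA : A ≤ hh a) (hB : B ≤ hh b) : (b-x) * A + (x-a) * B ≤ (b-a) * hh x := by
  have hl : 0 < Real.log 2 := Real.log_pos (by norm_num)
  obtain ⟨-, cc⟩ := Real.strictConcave_binEntropy.concaveOn
  have c := @cc a ⟨ha, by linarith⟩ b ⟨by linarith, hb⟩
    ((b-x)/(b-a)) ((x-a)/(b-a)) (div_nonneg (by linarith) (by linarith))
    (div_nonneg (by linarith) (by linarith))
    (by have : b - a ≠ 0 := by linarith
        field_simp; ring)
  have hne : 0 < b - a := by linarith
  simp only [smul_eq_mul] at c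
  have e : (b-x)/(b-a) * a + (x-a)/(b-a) * b = x := by field_simp; ring
  rw [e] at c
  have c2 : (b-x) * hh a + (x-a) * hh b ≤ (b-a) * hh x := by
    unfold hh
    have : (b-x) * (Real.binEntropy a / Real.log 2) + (x-a) * (Real.binEntropy b / Real.log 2) =
      (b-a) * (((b-x)/(b-a) * Real.binEntropy a + (x-a)/(b-a) * Real.binEntropy b) / Real.log 2) := by
      field_simp
    rw [this]
    gcongr
  have := mul_le_mul_of_nonneg_left hA (sub_nonneg.2 hx')
  have := mul_le_mul_of_nonneg_left hB (sub_nonneg.2 hx)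
  linarith

lemma hh_half : 1 ≤ hh (1/2) := by
  have := n1 (1/2) le_rfl (by norm_num)
  norm_num at this ⊢; exact this

lemma hh_one : 0 ≤ hh 1 := by simp [hh]

lemma hh_03 : 87/100 ≤ hh (3/10) := by
  have hl : 0 < Real.log 2 := Real.log_pos (by norm_num)
  unfold hh
  rw [le_div_iff₀ hl]
  have : Real.log (2^87 * 3^30 * 7^70) ≤ Real.log (10^100) := Real.log_le_log (by positivity) (by norm_num)
  rw [Real.log_mul (by positivity) (by positivity), Real.log_mul (by positivity) (by positivity)] at this
  simp only [Real.log_pow] at this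
  simp only [Real.binEntropy, Real.log_inv]
  rw [show (1 - 3/10:ℝ) = 7/10 by norm_num, Real.log_div (by norm_num) (by norm_num),
    Real.log_div (by norm_num) (by norm_num)]
  push_cast at this
  linarith

lemma hh_67 : 55/100 ≤ hh (6/7) := by
  have hl : 0 < Real.log 2 := Real.log_pos (by norm_num)
  unfold hh
  rw [le_div_iff₀ hl]
  have : Real.log (2^77 * 6^120) ≤ Real.log (7^140) := Real.log_le_log (by positivity) (by norm_num)
  rw [Real.log_mul (by positivity) (by positivity)] at this
  simp only [Real.log_pow] at this
  simp only [Real.binEntropy, Real.log_inv]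
  rw [show (1 - 6/7:ℝ) = 1/7 by norm_num, Real.log_div (by norm_num) (by norm_num),
    Real.log_div (by norm_num) (by norm_num), Real.log_one]
  push_cast at this
  linarith

lemma n2 (p : ℝ) (h1 : 3/10 ≤ p) (h2 : p ≤ 6/7) : FF p ≤ hh p + p - 1 := by
  unfold FF
  rcases le_total p (1/2) with h | h
  · have := conc (by norm_num) (by norm_num) (by norm_num) h1 h hh_03 hh_half
    rcases le_total p (464/1000) with h' | h'
    · refine (min_le_left _ _).trans ?_
      nlinarith
    · refine (min_le_right _ _).trans ?_
      linarith
  · have := conc (by norm_num) (by norm_num) (by norm_num) h h2 hh_half hh_67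
    refine (min_le_right _ _).trans ?_
    linarith

lemma n3 (p : ℝ) (h1 : 3/10 ≤ p) (h2 : p ≤ 1) : 0 ≤ hh p + p - 1 := by
  rcases le_total p (6/7) with h | h
  · exact (FF_nonneg p).trans (n2 p h1 h)
  · have := conc (by norm_num) (by norm_num) (by norm_num) h h2 hh_67 hh_one
    linarith

lemma n4 (p a : ℝ) (hp : 0 ≤ p) (hp' : p ≤ 3/10) (ha : 1/2 ≤ a) (ha' : 2*a-1 ≤ p) :
    1 - hh a ≤ a * FF (p/a) - FF p := by
  have h0 := n1 a ha (by linarith)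
  suffices (2*a-1)^2 + FF p ≤ a * FF (p/a) by linarith
  have hF : FF p ≤ 13/7*p^2 := min_le_left _ _
  have hm : (2*a-1)^2 ≤ p^2 := by nlinarith
  unfold FF at *
  rcases min_choice (13/7 * (p/a)^2) (2/5) with h | h <;> rw [h]
  · have : a * (13/7 * (p/a)^2) = 13/7 * p^2 / a := by field_simp
    rw [this]
    have : 20/7*p^2 ≤ 13/7 * p^2 / a := by
      rw [le_div_iff₀ (by linarith)]
      nlinarith [sq_nonneg p]
    linarith
  · have : p^2 ≤ 9/100 := by nlinarith
    nlinarith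

lemma n5 (p a M : ℝ) (hp : 0 ≤ p) (hp' : p ≤ 3/10) (ha : 1/2 ≤ a) (ha' : 2*a-1 ≤ M) (hM : M ≤ p) :
    1 - hh a ≤ a * FF (M/a) + (1-a) * FF (p/(1-a)) - FF p := by
  have h0 := n1 a ha (by linarith)
  suffices (2*a-1)^2 + FF p ≤ a * FF (M/a) + (1-a) * FF (p/(1-a)) by linarith
  have hF : FF p ≤ 13/7*p^2 := min_le_left _ _
  have hm : (2*a-1)^2 ≤ p^2 := by nlinarith
  have hb : 0 < 1 - a := by linarith
  have hnn : 0 ≤ a * FF (M/a) := mul_nonneg (by linarith) (FF_nonneg _)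
  have hp2 : p^2 ≤ 9/100 := by nlinarith
  rcases min_choice (13/7 * (p/(1-a))^2) (2/5) with h | h
  · have e : (1-a) * FF (p/(1-a)) = 13/7 * p^2 / (1-a) := by
      unfold FF; rw [h]; field_simp
    rw [e]
    have : 26/7*p^2 ≤ 13/7 * p^2 / (1-a) := by
      rw [le_div_iff₀ hb]
      nlinarith [sq_nonneg p]
    nlinarith
  · have e : FF (p/(1-a)) = 2/5 := h
    rw [e]
    have e2 : FF ((2*a-1)/a) ≤ FF (M/a) := FF_mono (div_nonneg (by linarith) (by linarith)) (by gcongr)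
    have e3 : 20/7 * (2*a-1)^2 ≤ a * FF ((2*a-1)/a) := by
      have e4 : (2*a-1)/a ≤ 464/1000 := by rw [div_le_iff₀ (by linarith)]; linarith
      have e5 : 0 ≤ (2*a-1)/a := div_nonneg (by linarith) (by linarith)
      have e6 : FF ((2*a-1)/a) = 13/7 * ((2*a-1)/a)^2 := min_eq_left (by nlinarith)
      rw [e6, show a * (13/7 * ((2*a-1)/a)^2) = 13/7 * (2*a-1)^2 / a by field_simp,
        le_div_iff₀ (by linarith)]
      nlinarith [sq_nonneg (2*a-1)]
    have e7 : a * FF ((2*a-1)/a) ≤ a * FF (M/a) := mul_le_mul_of_nonneg_left e2 (by linarith)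
    nlinarith [sq_nonneg (2*a-1-1/10)]

end TQ
namespace TQ

lemma oneD {Y : Type} [Fintype Y] [LinearOrder Y] (v : Y → ℝ) (Ach : Finset Y → ℝ → Prop)
    (hleaf : ∀ y, 0 < v y → Ach {y} 0)
    (hmono : ∀ B c c', Ach B c → c ≤ c' → Ach B c')
    (hlt : ∀ B y c₁ c₂, Ach (B.filter (fun z => z < y)) c₁ → Ach (B.filter (fun z => ¬ z < y)) c₂ →
      Ach B (∑ z ∈ B, v z + (c₁ + c₂)))
    (heq : ∀ B y c₁ c₂, Ach (B.filter (fun z => z = y)) c₁ → Ach (B.filter (fun z => ¬ z = y)) c₂ →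
      Ach B (∑ z ∈ B, v z + (c₁ + c₂))) (n : ℕ) :
    ∀ B : Finset Y, B.card ≤ n → B.Nonempty → (∀ y ∈ B, 0 < v y) →
      Ach B (eta (∑ z ∈ B, v z) - ∑ z ∈ B, eta (v z) + ∑ z ∈ B, v z) ∧
      ((∀ y ∈ B, v y ≤ 6/7 * ∑ z ∈ B, v z) → ∀ x ∈ B,
        Ach B (eta (∑ z ∈ B, v z) - ∑ z ∈ B, eta (v z) + ∑ z ∈ B, v z
          - (∑ z ∈ B, v z) * FF (v x / ∑ z ∈ B, v z))) := by
  induction n with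
  | zero =>
    intro B h hB; have := hB.card_pos; omega
  | succ n ih =>
    intro B hcard hB hpos
    obtain ⟨x, hx, hmax⟩ := B.exists_max_image v hB
    set V := ∑ z ∈ B, v z with hV
    have hVpos : 0 < V := Finset.sum_pos hpos hB
    have hxV : v x ≤ V := Finset.single_le_sum (fun i hi => (hpos i hi).le) hx
    have hvx := hpos x hx
    set p := v x / V with hp
    have hpV : v x = p * V := by rw [hp]; field_simp
    have hp0 : 0 < p := div_pos hvx hVpos
    have hp1 : p ≤ 1 := by rw [hp, div_le_one hVpos]; exact hxV
    -- reduce to a single max element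
    suffices H : Ach B (eta V - ∑ z ∈ B, eta (v z) + V) ∧ (p ≤ 6/7 →
        Ach B (eta V - ∑ z ∈ B, eta (v z) + V - V * FF p)) by
      refine ⟨H.1, fun h y hy => hmono _ _ _ (H.2 ?_) ?_⟩
      · rw [hp, div_le_iff₀ hVpos]; exact h x hx
      · have : FF (v y / V) ≤ FF p := FF_mono (div_nonneg (hpos y hy).le hVpos.le)
          (by rw [hp]; gcongr; exact hmax y hy)
        nlinarith
    rcases le_or_gt (3/10) p with hp3 | hp3
    · -- equality question
      have e1 : B.filter (fun z => z = x) = {x} := by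
        ext z; simp; rintro rfl; exact hx
      have e2 : B.filter (fun z => ¬ z = x) = B.erase x := by
        ext z; simp [and_comm]
      have s1 : V = v x + ∑ z ∈ B.erase x, v z := (Finset.add_sum_erase _ _ hx).symm
      have s2 : ∑ z ∈ B, eta (v z) = eta (v x) + ∑ z ∈ B.erase x, eta (v z) :=
        (Finset.add_sum_erase _ _ hx).symm
      rcases (B.erase x).eq_empty_or_nonempty with h0 | h0
      · rw [h0] at s1 s2
        simp only [Finset.sum_empty, add_zero] at s1 s2
        have hB1 : B = {x} := by
          rw [← Finset.insert_erase hx, h0]; rfl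
        have : p = 1 := by rw [hp, ← s1]; field_simp
        refine ⟨?_, fun h => by linarith⟩
        rw [s2, ← s1]
        have := hmono _ _ (V) (hleaf x hvx) hVpos.le
        rw [← hB1] at this
        simpa using this
      · have hrec := (ih (B.erase x) (by rw [Finset.card_erase_of_mem hx]; omega) h0
          (fun y hy => hpos y (Finset.mem_of_mem_erase hy))).1
        have s1' : ∑ z ∈ B.erase x, v z = (1-p) * V := by linarith
        have hp1' : p < 1 := by
          have := Finset.sum_pos (fun y hy => hpos y (Finset.mem_of_mem_erase hy)) h0
          rw [s1'] at this
          have := pos_of_mul_pos_left this hVpos.le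
          linarith
        have hh := heq B x _ _ (by rw [e1]; exact hleaf x hvx) (by rw [e2]; exact hrec)
        rw [← hV, s1'] at hh
        have hs := eta_split p V hp0 hp1' hVpos
        rw [← hpV] at hs
        refine ⟨hmono _ _ _ hh ?_, fun h => hmono _ _ _ hh ?_⟩
        · have := n3 p hp3 hp1
          nlinarith
        · have := n2 p hp3 h
          nlinarith
    · -- comparison question
      suffices H : Ach B (eta V - ∑ z ∈ B, eta (v z) + V - V * FF p) by
        refine ⟨hmono _ _ _ H ?_, fun _ => H⟩
        nlinarith [FF_nonneg p]
      -- abstract split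
      have key : ∀ (P : Y → Prop) [DecidablePred P] (x₀ : Y), x₀ ∈ B → P x₀ →
          1/2 * V ≤ ∑ z ∈ B.filter P, v z →
          2 * (∑ z ∈ B.filter P, v z) - V ≤ v x₀ →
          (∀ c₁ c₂, Ach (B.filter P) c₁ → Ach (B.filter (fun z => ¬ P z)) c₂ → Ach B (V + (c₁ + c₂))) →
          Ach B (eta V - ∑ z ∈ B, eta (v z) + V - V * FF p) := by
        intro P _ x₀ hx₀ hP h1 h2 hc
        have hx₀p : v x₀ ≤ p * V := by rw [← hpV]; exact hmax _ hx₀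
        set a := (∑ z ∈ B.filter P, v z) / V with ha
        have haV : ∑ z ∈ B.filter P, v z = a * V := by rw [ha]; field_simp
        have s1 := Finset.sum_filter_add_sum_filter_not B P v
        have s2 := Finset.sum_filter_add_sum_filter_not B P (fun z => eta (v z))
        have hbV : ∑ z ∈ B.filter (fun z => ¬ P z), v z = (1-a) * V := by linarith
        rw [haV] at h1 h2
        have ha1 : 1/2 ≤ a := le_of_mul_le_mul_right h1 hVpos
        set M := v x₀ / V with hM
        have hMV : v x₀ = M * V := by rw [hM]; field_simp
        have ha2 : 2*a-1 ≤ M := by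
          apply le_of_mul_le_mul_right _ hVpos; linarith
        have hMp : M ≤ p := by
          apply le_of_mul_le_mul_right _ hVpos; linarith
        have ne1 : (B.filter P).Nonempty := ⟨x₀, by simp [hx₀, hP]⟩
        have ne2 : (B.filter (fun z => ¬ P z)).Nonempty := by
          rw [Finset.nonempty_iff_ne_empty]
          intro h
          rw [h, Finset.sum_empty] at hbV
          nlinarith
        have c12 := Finset.card_filter_add_card_filter_not (s := B) P
        have d1 := ne1.card_pos
        have d2 := ne2.card_pos
        obtain ⟨A1, A2⟩ := ih (B.filter P) (by omega) ne1
          (fun y hy => hpos y (Finset.mem_of_mem_filter _ hy))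
        obtain ⟨B1, B2⟩ := ih (B.filter (fun z => ¬ P z)) (by omega) ne2
          (fun y hy => hpos y (Finset.mem_of_mem_filter _ hy))
        rw [haV] at A1 A2
        rw [hbV] at B1 B2
        replace A2 := A2 (fun y hy => by
          have := hmax y (Finset.mem_of_mem_filter _ hy)
          nlinarith)
        replace B2 := B2 (fun y hy => by
          have := hmax y (Finset.mem_of_mem_filter _ hy)
          nlinarith)
        have hs := eta_split a V (by linarith) (by linarith) hVpos
        have q1 : ∀ t, t / (a*V) = t/V/a := fun t => by rw [mul_comm, div_div]
        have q2 : ∀ t, t / ((1-a)*V) = t/V/(1-a) := fun t => by rw [mul_comm, div_div]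
        simp only [q1] at A2
        simp only [q2] at B2
        by_cases hPx : P x
        · refine hmono _ _ _ (hc _ _ (A2 x (by simp [hx, hPx])) B1) ?_
          have := n4 p a hp0.le hp3.le ha1 (by linarith)
          rw [← hp]
          have := mul_le_mul_of_nonneg_left this hVpos.le
          linarith
        · refine hmono _ _ _ (hc _ _ (A2 x₀ (by simp [hx₀, hP])) (B2 x (by simp [hx, hPx]))) ?_
          have := n5 p a M hp0.le hp3.le ha1 ha2 hMp
          rw [← hp, ← hM]
          have := mul_le_mul_of_nonneg_left this hVpos.le
          linarith
      -- find the middle element, as an element of B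
      have hne : (B.filter (fun y => ∑ z ∈ B.filter (fun z => z < y), v z ≤ 1/2 * V)).Nonempty := by
        refine ⟨B.min' hB, ?_⟩
        rw [Finset.mem_filter]
        refine ⟨B.min'_mem hB, ?_⟩
        have : B.filter (fun z => z < B.min' hB) = ∅ := by
          rw [Finset.filter_eq_empty_iff]
          intro z hz
          exact not_lt.2 (B.min'_le z hz)
        rw [this, Finset.sum_empty]; positivity
      set m := Finset.max' _ hne with hm
      have hmm := Finset.max'_mem _ hne
      rw [← hm, Finset.mem_filter] at hmm
      obtain ⟨hmB, hmL⟩ := hmm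
      set L := ∑ z ∈ B.filter (fun z => z < m), v z with hL
      have sL := Finset.sum_filter_add_sum_filter_not B (fun z => z < m) v
      have hle : ∑ z ∈ B.filter (fun z => z ≤ m), v z = L + v m := by
        have : B.filter (fun z => z ≤ m) = insert m (B.filter (fun z => z < m)) := by
          ext z; simp only [Finset.mem_filter, Finset.mem_insert, le_iff_lt_or_eq]
          constructor
          · rintro ⟨h, h' | h'⟩ <;> tauto
          · rintro (rfl | h)
            · exact ⟨hmB, Or.inr rfl⟩
            · tauto
        rw [this, Finset.sum_insert (by simp), add_comm]
      have hmp : v m ≤ p * V := by rw [← hpV]; exact hmax _ hmB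
      -- next element of B
      have hne2 : (B.filter (fun z => m < z)).Nonempty := by
        rw [Finset.nonempty_iff_ne_empty]
        intro h
        rw [Finset.filter_eq_empty_iff] at h
        have : B.filter (fun z => z ≤ m) = B := by
          rw [Finset.filter_eq_self]; intro z hz; exact not_lt.1 (h hz)
        rw [this, ← hV] at hle
        nlinarith
      set m' := Finset.min' _ hne2 with hm'
      have hmm' := Finset.min'_mem _ hne2
      rw [← hm', Finset.mem_filter] at hmm'
      have hiff : ∀ z ∈ B, (z < m' ↔ z ≤ m) := by
        intro z hz
        constructor
        · intro h
          by_contra h'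
          exact absurd (Finset.min'_le _ z (by simp [hz]; exact not_le.1 h')) (not_le.2 h)
        · intro h; exact h.trans_lt hmm'.2
      have hfil : B.filter (fun z => z < m') = B.filter (fun z => z ≤ m) := Finset.filter_congr hiff
      have hgt : 1/2 * V < L + v m := by
        by_contra h
        rw [← hle, ← hfil, not_lt] at h
        have : m' ≤ m := Finset.le_max' _ m' (Finset.mem_filter.2 ⟨hmm'.1, h⟩)
        exact absurd hmm'.2 (not_lt.2 this)
      rcases le_total (V - 2 * L) (v m) with hc | hc
      · refine key (fun z => ¬ z < m) m hmB (lt_irrefl _) (by linarith) (by linarith) ?_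
        intro c₁ c₂ h1 h2
        simp only [not_not] at h2
        rw [add_comm c₁]
        exact hlt B m c₂ c₁ h2 h1
      · refine key (fun z => z < m') m hmB hmm'.2 (by rw [hfil]; linarith) (by rw [hfil]; linarith) ?_
        intro c₁ c₂ h1 h2
        exact hlt B m' c₁ c₂ h1 h2

end TQ
namespace TQ

structure TreeFor {α : Type} [DecidableEq α] (G : Finset α → Prop) (w : α → ℝ) (S : Finset α) (c : ℝ) (T : DTree α) : Prop where
  nodup : T.leaves.Nodup
  mem_leaves : ∀ x, x ∈ T.leaves ↔ x ∈ S
  finds : ∀ x ∈ S, T.find? x = some (T.depth x)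
  good : ∀ q ∈ T.questions, G q
  cost_le : ∑ x ∈ S, w x * (T.depth x : ℝ) ≤ c

lemma treeFor_leaf {α : Type} [DecidableEq α] (G : Finset α → Prop) (w : α → ℝ) (x : α) :
    TreeFor G w {x} 0 (.leaf x) := by
  refine ⟨by simp [DTree.leaves], by simp [DTree.leaves], ?_, by simp [DTree.questions], ?_⟩
  · simp [DTree.find?, DTree.depth]
  · simp [DTree.find?, DTree.depth]

lemma treeFor_node {α : Type} [DecidableEq α] (G : Finset α → Prop) (w : α → ℝ) (S S₁ S₂ q : Finset α)
    (hq : G q) (h₁ : ∀ x, x ∈ S₁ ↔ x ∈ S ∧ x ∈ q) (h₂ : ∀ x, x ∈ S₂ ↔ x ∈ S ∧ x ∉ q) (c₁ c₂ : ℝ) (T₁ T₂ : DTree α)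
    (t₁ : TreeFor G w S₁ c₁ T₁) (t₂ : TreeFor G w S₂ c₂ T₂) :
    TreeFor G w S (∑ x ∈ S, w x + (c₁ + c₂)) (.node q T₁ T₂) := by
  have f₁ : ∀ x ∈ S₁, (DTree.node q T₁ T₂).find? x = some (T₁.depth x + 1) := by
    intro x hx
    simp [DTree.find?, ((h₁ x).1 hx).2, t₁.finds x hx]
  have f₂ : ∀ x ∈ S₂, (DTree.node q T₁ T₂).find? x = some (T₂.depth x + 1) := by
    intro x hx
    simp [DTree.find?, ((h₂ x).1 hx).2, t₂.finds x hx]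
  have hS : ∀ x, x ∈ S ↔ x ∈ S₁ ∨ x ∈ S₂ := by
    intro x; rw [h₁, h₂]; tauto
  have hd : Disjoint S₁ S₂ := by
    rw [Finset.disjoint_left]; intro x; rw [h₁, h₂]; tauto
  have hSu : S = S₁ ∪ S₂ := by ext x; rw [hS, Finset.mem_union]
  refine ⟨?_, ?_, ?_, ?_, ?_⟩
  · rw [DTree.leaves, List.nodup_append']
    refine ⟨t₁.nodup, t₂.nodup, ?_⟩
    intro x hx hx'
    rw [t₁.mem_leaves] at hx
    rw [t₂.mem_leaves] at hx'
    exact Finset.disjoint_left.1 hd hx hx'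
  · intro x
    rw [DTree.leaves, List.mem_append, t₁.mem_leaves, t₂.mem_leaves, hS]
  · intro x hx
    rcases (hS x).1 hx with h | h
    · simp [DTree.depth, f₁ x h]
    · simp [DTree.depth, f₂ x h]
  · intro r hr
    simp only [DTree.questions, Set.mem_insert_iff, Set.mem_union] at hr
    rcases hr with rfl | h | h
    · exact hq
    · exact t₁.good _ h
    · exact t₂.good _ h
  · rw [hSu, Finset.sum_union hd, Finset.sum_union hd]
    have g₁ : ∑ x ∈ S₁, w x * ((DTree.node q T₁ T₂).depth x : ℝ) = ∑ x ∈ S₁, w x * (T₁.depth x : ℝ) + ∑ x ∈ S₁, w x := by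
      rw [← Finset.sum_add_distrib]
      refine Finset.sum_congr rfl fun x hx => ?_
      rw [DTree.depth, f₁ x hx]; simp; ring
    have g₂ : ∑ x ∈ S₂, w x * ((DTree.node q T₁ T₂).depth x : ℝ) = ∑ x ∈ S₂, w x * (T₂.depth x : ℝ) + ∑ x ∈ S₂, w x := by
      rw [← Finset.sum_add_distrib]
      refine Finset.sum_congr rfl fun x hx => ?_
      rw [DTree.depth, f₂ x hx]; simp; ring
    rw [g₁, g₂]
    linarith [t₁.cost_le, t₂.cost_le]

def GoodQ (Y : Type) [Fintype Y] [LinearOrder Y] (k : ℕ) (q : Finset (Fin k → Y)) : Prop :=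
  (∃ (i : Fin k) (y : Y), q = Finset.univ.filter (fun z => z i < y)) ∨
        (∃ (i : Fin k) (y : Y), q = Finset.univ.filter (fun z => z i = y))

lemma multi (Y : Type) [Fintype Y] [LinearOrder Y] (k : ℕ) (w : (Fin k → Y) → ℝ) (J : Finset (Fin k)) :
    ∀ S : Finset (Fin k → Y), S.Nonempty → (∀ x ∈ S, 0 < w x) →
      (∀ x ∈ S, ∀ z ∈ S, ∀ i, i ∉ J → x i = z i) →
      ∃ T, TreeFor (GoodQ Y k) w S
        (eta (∑ x ∈ S, w x) - ∑ x ∈ S, eta (w x) + J.card * ∑ x ∈ S, w x) T := by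
  induction J using Finset.induction_on with
  | empty =>
    intro S ⟨x, hx⟩ hpos hag
    have : S = {x} := by
      rw [Finset.eq_singleton_iff_unique_mem]
      exact ⟨hx, fun z hz => funext fun i => hag z hz x hx i (by simp)⟩
    subst this
    exact ⟨_, by simpa using treeFor_leaf (GoodQ Y k) w x⟩
  | insert i J hi ih =>
    intro S hS hpos hag
    set v : Y → ℝ := fun y => ∑ x ∈ S.filter (fun x => x i = y), w x with hv
    set c : Y → ℝ := fun y => eta (v y) - ∑ x ∈ S.filter (fun x => x i = y), eta (w x) + J.card * v y with hc
    have hfib : ∀ (B : Finset Y) (f : (Fin k → Y) → ℝ),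
        ∑ y ∈ B, ∑ x ∈ S.filter (fun x => x i = y), f x = ∑ x ∈ S.filter (fun x => x i ∈ B), f x := by
      intro B f
      rw [← Finset.sum_fiberwise_of_maps_to (s := S.filter (fun x => x i ∈ B)) (t := B) (g := fun x => x i)
        (by intro x hx; exact (Finset.mem_filter.1 hx).2)]
      refine Finset.sum_congr rfl fun y hy => Finset.sum_congr ?_ fun _ _ => rfl
      ext x; simp only [Finset.mem_filter]
      constructor
      · rintro ⟨h, rfl⟩; exact ⟨⟨h, hy⟩, rfl⟩
      · rintro ⟨⟨h, _⟩, h'⟩; exact ⟨h, h'⟩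
    set Ach : Finset Y → ℝ → Prop := fun B r =>
      ∃ T, TreeFor (GoodQ Y k) w (S.filter (fun x => x i ∈ B)) (∑ y ∈ B, c y + r) T with hAch
    have main := oneD v Ach ?_ ?_ ?_ ?_ (S.image (fun x => x i)).card (S.image (fun x => x i)) le_rfl
      (hS.image _) ?_
    · obtain ⟨T, hT⟩ := main.1
      refine ⟨T, ?_⟩
      have hself : S.filter (fun x => x i ∈ S.image (fun x => x i)) = S := by
        rw [Finset.filter_eq_self]; intro x hx; exact Finset.mem_image_of_mem _ hx
      have sv := hfib (S.image (fun x => x i)) w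
      have se := hfib (S.image (fun x => x i)) (fun x => eta (w x))
      rw [hself] at hT sv se
      convert hT using 1
      rw [Finset.card_insert_of_notMem hi]
      simp only [hc, Finset.sum_add_distrib, Finset.sum_sub_distrib, ← Finset.mul_sum]
      rw [se]
      simp only [hv]
      rw [sv]
      push_cast
      ring
    · intro y hy
      have hne : (S.filter (fun x => x i = y)).Nonempty := by
        rw [Finset.nonempty_iff_ne_empty]; intro h
        simp only [hv, h, Finset.sum_empty] at hy
        exact lt_irrefl _ hy
      obtain ⟨T, hT⟩ := ih (S.filter (fun x => x i = y)) hne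
        (fun x hx => hpos x (Finset.mem_of_mem_filter _ hx)) (by
          intro x hx z hz j hj
          rw [Finset.mem_filter] at hx hz
          by_cases h : j = i
          · subst h; rw [hx.2, hz.2]
          · exact hag x hx.1 z hz.1 j (by simp [h, hj]))
      refine ⟨T, ?_⟩
      simpa [hc, hv] using hT
    · rintro B c c' ⟨T, hT⟩ h
      exact ⟨T, hT.1, hT.2, hT.3, hT.4, hT.5.trans (by linarith)⟩
    · rintro B y c₁ c₂ ⟨T₁, h₁⟩ ⟨T₂, h₂⟩
      refine ⟨.node (Finset.univ.filter (fun z => z i < y)) T₁ T₂, ?_⟩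
      have := treeFor_node (GoodQ Y k) w (S.filter (fun x => x i ∈ B)) _ _
        (Finset.univ.filter (fun z => z i < y)) (Or.inl ⟨i, y, rfl⟩) ?_ ?_ _ _ _ _ h₁ h₂
      · convert this using 1
        rw [← hfib, ← Finset.sum_filter_add_sum_filter_not B (fun z => z < y) c]
        ring
      · intro x; simp; tauto
      · intro x; simp; tauto
    · rintro B y c₁ c₂ ⟨T₁, h₁⟩ ⟨T₂, h₂⟩
      refine ⟨.node (Finset.univ.filter (fun z => z i = y)) T₁ T₂, ?_⟩
      have := treeFor_node (GoodQ Y k) w (S.filter (fun x => x i ∈ B)) _ _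
        (Finset.univ.filter (fun z => z i = y)) (Or.inr ⟨i, y, rfl⟩) ?_ ?_ _ _ _ _ h₁ h₂
      · convert this using 1
        rw [← hfib, ← Finset.sum_filter_add_sum_filter_not B (fun z => z = y) c]
        ring
      · intro x; simp only [Finset.mem_filter, Finset.mem_univ, true_and]; tauto
      · intro x; simp only [Finset.mem_filter, Finset.mem_univ, true_and]; tauto
    · intro y hy
      obtain ⟨x, hx, rfl⟩ := Finset.mem_image.1 hy
      exact Finset.sum_pos (fun z hz => hpos z (Finset.mem_of_mem_filter _ hz))
        ⟨x, by simp [hx]⟩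

end TQ

open TQ in
/-- For vectors of length `k` over a finite linearly ordered set `Y`, every distribution
admits a valid decision tree using only entry-wise comparison and entry-wise equality
questions, of cost at most `H(π) + k`. -/
theorem entrywise_comparison_equality_redundancy_k
    (Y : Type) [Fintype Y] [LinearOrder Y] (k : ℕ) (hk : 1 ≤ k)
    (π : (Fin k → Y) → ℝ) (hπ : IsDistribution π) :
    ∃ T : DTree (Fin k → Y), IsValid T π ∧
      (∀ q ∈ T.questions,
        (∃ (i : Fin k) (y : Y), q = Finset.univ.filter (fun z => z i < y)) ∨
        (∃ (i : Fin k) (y : Y), q = Finset.univ.filter (fun z => z i = y))) ∧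
      cost T π ≤ entropy π + (k : ℝ) := by
  have hsum : ∀ f : (Fin k → Y) → ℝ, (∀ x, π x = 0 → f x = 0) →
      ∑ x ∈ Finset.univ.filter (fun x => π x ≠ 0), f x = ∑ x, f x := by
    intro f hf
    refine Finset.sum_subset (Finset.subset_univ _) fun x _ hx => hf x ?_
    simpa using hx
  have h1 : ∑ x ∈ Finset.univ.filter (fun x => π x ≠ 0), π x = 1 := by
    rw [hsum π (fun _ h => h)]; exact hπ.2
  obtain ⟨T, hT⟩ := multi Y k π Finset.univ (Finset.univ.filter (fun x => π x ≠ 0))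
    (by rw [Finset.nonempty_iff_ne_empty]; intro h; rw [h] at h1; simp at h1)
    (fun x hx => lt_of_le_of_ne (hπ.1 x) (by simpa [eq_comm] using hx))
    (fun x _ z _ i hi => absurd (Finset.mem_univ i) hi)
  refine ⟨T, ⟨hT.nodup, fun x => by rw [hT.mem_leaves]; simp, fun x hx => hT.finds x (by simpa using hx)⟩,
    hT.good, ?_⟩
  have := hT.cost_le
  rw [h1, hsum _ (fun x h => by simp [h]), hsum _ (fun x h => by simp [eta, h])] at this
  simp only [cost, entropy]
  rw [Finset.sum_neg_distrib]
  simpa [eta, sub_eq_add_neg] using this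
end

section
/- For every δ > 0 there exists N such that for all n ≥ N, u_Opt(n,0) ≤ (1.25 + δ)^n; that is, for every n there is a set Q of at most 1.25^{n+o(n)} subsets of X_n such that every probability distribution on X_n admits a decision tree using only questions from Q whose cost equals the unrestricted optimal cost. -/
namespace TQ
section comb
variable {β : Type} [DecidableEq β]

def Spl (w : β → ℕ) (U : Finset β) : Finset (Finset β) :=
  U.powerset.filter (fun S => 2 * ∑ x ∈ S, w x = ∑ x ∈ U, w x)

noncomputable def Wt (w : β → ℕ) (U : Finset β) : ℝ := ∑ S ∈ Spl w U, (1/4:ℝ)^S.card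

def Nice (e : β → ℕ) (U : Finset β) (B : ℕ) : Prop :=
  (∀ x ∈ U, e x < B) ∧ 2^B ∣ ∑ x ∈ U, 2^e x

theorem exact_subset (e : β → ℕ) (B M : ℕ) (hM : 2^B ∣ M) :
    ∀ (c : ℕ) (V : Finset β), V.card ≤ c → (∀ x ∈ V, e x ≤ B) → M ≤ ∑ x ∈ V, 2^e x →
      ∃ P ⊆ V, ∑ x ∈ P, 2^e x = M := by
  intro c
  induction c with
  | zero =>
    intro V hc h hs
    have : V = ∅ := Finset.card_eq_zero.mp (by omega)
    subst this
    exact ⟨∅, by simp, by simp at hs ⊢; omega⟩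
  | succ c ih =>
    intro V hc h hs
    rcases hs.eq_or_lt with h1 | h1
    · exact ⟨V, subset_rfl, h1.symm⟩
    have hne : V.Nonempty := by
      rw [Finset.nonempty_iff_ne_empty]; rintro rfl; simp at h1
    obtain ⟨x, hx, hmin⟩ := Finset.exists_min_image V e hne
    have hd1 : 2^e x ∣ ∑ y ∈ V, 2^e y := Finset.dvd_sum (fun y hy => pow_dvd_pow 2 (hmin y hy))
    have hd2 : 2^e x ∣ M := (pow_dvd_pow 2 (h x hx)).trans hM
    have h3 := Finset.add_sum_erase V (fun y => 2^e y) hx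
    have h4 : 2^e x ≤ (∑ y ∈ V, 2^e y) - M := Nat.le_of_dvd (by omega) (Nat.dvd_sub hd1 hd2)
    obtain ⟨P, hP, hPs⟩ := ih (V.erase x) (by rw [Finset.card_erase_of_mem hx]; omega)
      (fun y hy => h y (Finset.mem_of_mem_erase hy)) (by omega)
    exact ⟨P, hP.trans (Finset.erase_subset _ _), hPs⟩

theorem Wt_nonneg (w : β → ℕ) (U : Finset β) : 0 ≤ Wt w U :=
  Finset.sum_nonneg (fun _ _ => by positivity)

theorem le_Wt (w : β → ℕ) (U S : Finset β) (hS : S ⊆ U)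
    (h : 2 * ∑ x ∈ S, w x = ∑ x ∈ U, w x) : (1/4:ℝ)^S.card ≤ Wt w U := by
  unfold Wt
  exact Finset.single_le_sum (f := fun S : Finset β => (1/4:ℝ)^S.card) (fun _ _ => by positivity)
    (by simp [Spl, hS, h])

theorem Wt_step (w : β → ℕ) (U D U' : Finset β) (k m : ℕ) (hD : D ⊆ U) (hU' : U' ⊆ U)
    (hdis : Disjoint D U') (hw : ∀ x ∈ D, w x = m)
    (hsum : 2 * (k * m) + ∑ x ∈ U', w x = ∑ x ∈ U, w x) :
    (D.card.choose k : ℝ) * (1/4:ℝ)^k * Wt w U' ≤ Wt w U := by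
  have hL : (D.card.choose k : ℝ) * (1/4:ℝ)^k * Wt w U'
      = ∑ p ∈ D.powersetCard k ×ˢ Spl w U', (1/4:ℝ)^(p.1 ∪ p.2).card := by
    rw [Finset.sum_product]
    have : ∀ A ∈ D.powersetCard k, ∑ S ∈ Spl w U', (1/4:ℝ)^(A ∪ S).card
        = (1/4:ℝ)^k * Wt w U' := by
      intro A hA
      rw [Finset.mem_powersetCard] at hA
      unfold Wt
      rw [Finset.mul_sum]
      refine Finset.sum_congr rfl fun S hS => ?_
      simp only [Spl, Finset.mem_filter, Finset.mem_powerset] at hS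
      rw [Finset.card_union_of_disjoint (Finset.disjoint_of_subset_left hA.1
        (Finset.disjoint_of_subset_right hS.1 hdis)), hA.2, pow_add]
    rw [Finset.sum_congr rfl this, Finset.sum_const, Finset.card_powersetCard, nsmul_eq_mul,
      mul_assoc]
  rw [hL]
  have hinj : Set.InjOn (fun p : Finset β × Finset β => p.1 ∪ p.2)
      (D.powersetCard k ×ˢ Spl w U' : Finset (Finset β × Finset β)) := by
    rintro ⟨A, S⟩ h1 ⟨A', S'⟩ h2 h
    simp only [Finset.coe_product, Set.mem_prod, Finset.mem_coe, Finset.mem_powersetCard, Spl,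
      Finset.mem_filter, Finset.mem_powerset] at h1 h2
    have hdis' := Finset.disjoint_left.mp hdis
    simp only at h
    have h' := fun x => Finset.ext_iff.mp h x
    simp only [Finset.mem_union] at h'
    ext x
    · simp only
      have := h' x
      constructor
      · intro hx
        rcases this.mp (Or.inl hx) with h | h
        · exact h
        · exact absurd (h2.2.1 h) (hdis' (h1.1.1 hx))
      · intro hx
        rcases this.mpr (Or.inl hx) with h | h
        · exact h
        · exact absurd (h1.2.1 h) (hdis' (h2.1.1 hx))
    · simp only
      have := h' x
      constructor
      · intro hx
        rcases this.mp (Or.inr hx) with h | h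
        · exact absurd (h1.2.1 hx) (hdis' (h2.1.1 h))
        · exact h
      · intro hx
        rcases this.mpr (Or.inr hx) with h | h
        · exact absurd (h2.2.1 hx) (hdis' (h1.1.1 h))
        · exact h
  rw [← Finset.sum_image (f := fun S : Finset β => (1/4:ℝ)^S.card) hinj]
  unfold Wt
  apply Finset.sum_le_sum_of_subset_of_nonneg
  · intro S hS
    rw [Finset.mem_image] at hS
    obtain ⟨⟨A, S'⟩, h1, rfl⟩ := hS
    simp only [Finset.mem_product, Finset.mem_powersetCard, Spl,
      Finset.mem_filter, Finset.mem_powerset] at h1 ⊢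
    refine ⟨Finset.union_subset (h1.1.1.trans hD) (h1.2.1.trans hU'), ?_⟩
    rw [Finset.sum_union (Finset.disjoint_of_subset_left h1.1.1
        (Finset.disjoint_of_subset_right h1.2.1 hdis)),
      Finset.sum_congr rfl (fun x hx => hw x (h1.1.1 hx)), Finset.sum_const, h1.1.2, smul_eq_mul,
      mul_add, h1.2.2, hsum]
  · intros; positivity

theorem choose_bound (c k : ℕ) (hk : k = (c+1)/2) : 4^k ≤ 2*(c+1) * c.choose k := by
  have h1 : 2^c ≤ (c+1) * c.choose k := by
    rw [← Nat.sum_range_choose]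
    have hk' : c.choose k = c.choose (c/2) := by
      apply Nat.choose_symm_of_eq_add; omega
    calc _ ≤ ∑ i ∈ Finset.range (c+1), c.choose k :=
          Finset.sum_le_sum (fun i _ => by rw [hk']; exact Nat.choose_le_middle i c)
      _ = _ := by simp
  have h2 : 4^k ≤ 2^(c+1) := by
    rw [show 4 = 2^2 by rfl, ← pow_mul]; exact Nat.pow_le_pow_right (by norm_num) (by omega)
  rw [pow_succ] at h2
  nlinarith

theorem nice_step (e : β → ℕ) (n : ℕ) (U : Finset β) (hn : U.card ≤ n) (B : ℕ)
    (h : Nice e U (B+1)) :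
    ∃ U' ⊆ U, Nice e U' B ∧ Wt (fun x => 2^e x) U' ≤ (2*n+2) * Wt (fun x => 2^e x) U := by
  obtain ⟨h1, h2⟩ := h
  set D := U.filter (fun x => e x = B) with hDdef
  set R := U.filter (fun x => ¬ e x = B) with hRdef
  have hDR : ∑ x ∈ D, 2^e x + ∑ x ∈ R, 2^e x = ∑ x ∈ U, 2^e x :=
    Finset.sum_filter_add_sum_filter_not _ _ _
  have hDs : ∑ x ∈ D, 2^e x = D.card * 2^B := by
    rw [Finset.sum_congr rfl (g := fun _ => 2^B)]
    · simp
    · intro x hx; rw [(Finset.mem_filter.mp hx).2]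
  set c := D.card with hc
  set k := (c+1)/2 with hk
  have hRe : ∀ x ∈ R, e x < B := fun x hx => by
    rw [hRdef, Finset.mem_filter] at hx
    have := h1 x hx.1
    omega
  obtain ⟨s, hs⟩ := h2
  have hE : ∃ E ⊆ R, ∑ x ∈ E, 2^e x = (2*k-c) * 2^B := by
    apply exact_subset e B _ (Dvd.intro_left _ rfl) R.card R le_rfl (fun x hx => (hRe x hx).le)
    have h3 : c * 2^B + ∑ x ∈ R, 2^e x = (2*s) * 2^B := by
      rw [← hDs, hDR, hs]; ring
    have h4 : c ≤ 2*s := by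
      have : c * 2^B ≤ (2*s) * 2^B := by omega
      exact Nat.le_of_mul_le_mul_right this (by positivity)
    have h5 : 2*k ≤ 2*s := by omega
    have h6 : (2*k-c)*2^B ≤ (2*s-c)*2^B := Nat.mul_le_mul_right _ (by omega)
    have h7 : (2*s-c)*2^B + c*2^B = (2*s)*2^B := by rw [← add_mul]; congr 1; omega
    omega
  obtain ⟨E, hER, hEs⟩ := hE
  have hRU : R ⊆ U := Finset.filter_subset _ _
  have hDU : D ⊆ U := Finset.filter_subset _ _
  have hsd : ∑ x ∈ R \ E, 2^e x + ∑ x ∈ E, 2^e x = ∑ x ∈ R, 2^e x := Finset.sum_sdiff hER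
  have hsum : 2 * (k * 2^B) + ∑ x ∈ R \ E, 2^e x = ∑ x ∈ U, 2^e x := by
    have : (2*k-c)*2^B + c*2^B = 2*(k*2^B) := by
      rw [← add_mul, ← mul_assoc]; congr 1; omega
    omega
  refine ⟨R \ E, Finset.sdiff_subset.trans hRU, ⟨fun x hx => hRe x (Finset.mem_sdiff.mp hx).1, ?_⟩, ?_⟩
  · have h8 : 2^B ∣ 2 * (k * 2^B) := ⟨2*k, by ring⟩
    refine (Nat.dvd_add_right h8).mp ?_
    rw [hsum, hs, pow_succ, mul_assoc]
    exact Dvd.intro _ rfl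
  · have hst := Wt_step (fun x => 2^e x) U D (R \ E) k (2^B) hDU (Finset.sdiff_subset.trans hRU)
      (by
        rw [Finset.disjoint_left]; intro x hx hx'
        exact (Finset.mem_filter.mp (Finset.mem_sdiff.mp hx').1).2 (Finset.mem_filter.mp hx).2)
      (by intro x hx; rw [(Finset.mem_filter.mp hx).2]) hsum
    rw [← hc] at hst
    have hb := choose_bound c k hk
    have hb' : (4:ℝ)^k ≤ 2*((c:ℝ)+1) * (c.choose k) := by exact_mod_cast hb
    have hcn : (c:ℝ) ≤ n := by exact_mod_cast (Finset.card_le_card hDU).trans hn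
    have h0 := Wt_nonneg (fun x => 2^e x) (R \ E)
    have h9 : 1 ≤ (2*(n:ℝ)+2) * (c.choose k * (1/4:ℝ)^k) := by
      have : (1:ℝ) = 4^k * (1/4:ℝ)^k := by rw [← mul_pow]; norm_num
      rw [← mul_assoc]
      refine this.le.trans ?_
      gcongr
      refine hb'.trans ?_
      gcongr
      linarith
    calc _ = 1 * Wt (fun x => 2^e x) (R \ E) := by ring
      _ ≤ (2*(n:ℝ)+2) * (c.choose k * (1/4:ℝ)^k) * Wt (fun x => 2^e x) (R \ E) := by gcongr
      _ = (2*(n:ℝ)+2) * (c.choose k * (1/4:ℝ)^k * Wt (fun x => 2^e x) (R \ E)) := by ring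
      _ ≤ _ := by gcongr

theorem nice_steps (e : β → ℕ) (n : ℕ) (t : ℕ) : ∀ (U : Finset β) (_ : U.card ≤ n) (B : ℕ)
    (_ : Nice e U B),
    ∃ U' ⊆ U, Nice e U' (B-t) ∧ Wt (fun x => 2^e x) U' ≤ (2*n+2)^t * Wt (fun x => 2^e x) U := by
  induction t with
  | zero => intro U _ B h; exact ⟨U, subset_rfl, by simpa using h, by simp⟩
  | succ t ih =>
    intro U hn B h
    obtain ⟨U', hU', hN, hW⟩ := ih U hn B h
    rcases Nat.eq_zero_or_pos (B-t) with h0 | h0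
    · refine ⟨U', hU', by rwa [show B-(t+1) = B-t by omega], hW.trans ?_⟩
      have := Wt_nonneg (fun x => 2^e x) U
      gcongr
      · have : (0:ℝ) ≤ n := by positivity
        linarith
      · omega
    · rw [show B-t = (B-(t+1))+1 by omega] at hN
      obtain ⟨V, hV, hVN, hVW⟩ := nice_step e n U' ((Finset.card_le_card hU').trans hn) _ hN
      refine ⟨V, hV.trans hU', hVN, hVW.trans ?_⟩
      rw [pow_succ']
      rw [mul_assoc]
      gcongr

theorem Wt_main (e : β → ℕ) (n t L : ℕ) (ht : n ≤ 2^t) (q : ℕ) :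
    ∀ (U : Finset β) (_ : U.card ≤ n) (B : ℕ) (_ : Nice e U B) (_ : U.card < (q+1) * L),
      (1/4:ℝ)^L ≤ ((2*n+2)^t)^q * Wt (fun x => 2^e x) U := by
  -- the direct case: few heavy elements
  have key : ∀ (U : Finset β) (_ : U.card ≤ n) (B : ℕ) (_ : Nice e U B)
      (_ : (U.filter (fun x => B ≤ e x + t)).card < L),
      (1/4:ℝ)^L ≤ Wt (fun x => 2^e x) U := by
    intro U hn B hN hV
    suffices h : ∃ P ⊆ U.filter (fun x => B ≤ e x + t),
        2 * ∑ x ∈ P, 2^e x = ∑ x ∈ U, 2^e x by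
      obtain ⟨P, hP, hs⟩ := h
      refine le_trans ?_ (le_Wt _ U P (hP.trans (Finset.filter_subset _ _)) hs)
      exact pow_le_pow_of_le_one (by norm_num) (by norm_num)
        ((Finset.card_le_card hP).trans hV.le)
    rcases U.eq_empty_or_nonempty with rfl | hne
    · exact ⟨∅, by simp, by simp⟩
    have hpos : 0 < ∑ x ∈ U, 2^e x := Finset.sum_pos (fun _ _ => by positivity) hne
    obtain ⟨x0, hx0⟩ := hne
    have hB := hN.1 x0 hx0
    obtain ⟨s, hs⟩ := hN.2
    obtain ⟨b, rfl⟩ : ∃ b, B = b+1 := ⟨B-1, by omega⟩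
    have hs' : ∑ x ∈ U, 2^e x = 2 * (2^b * s) := by rw [hs]; ring
    have hsp := Finset.sum_filter_add_sum_filter_not U (fun x => b+1 ≤ e x + t) (fun x => 2^e x)
    have hge : 2^b * s ≤ ∑ x ∈ U.filter (fun x => b+1 ≤ e x + t), 2^e x := by
      by_contra hlt
      push Not at hlt
      have hs1 : 1 ≤ s := by
        rcases Nat.eq_zero_or_pos s with h | h
        · rw [h] at hs'; omega
        · exact h
      have hl : (∑ x ∈ U.filter (fun x => ¬ b+1 ≤ e x + t), 2^e x) * 2^t ≤ n * 2^b := by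
        rw [Finset.sum_mul]
        calc _ ≤ ∑ x ∈ U.filter (fun x => ¬ b+1 ≤ e x + t), 2^b := by
              refine Finset.sum_le_sum fun x hx => ?_
              rw [← pow_add]
              have := (Finset.mem_filter.mp hx).2
              exact Nat.pow_le_pow_right (by norm_num) (by omega)
          _ ≤ _ := by
              rw [Finset.sum_const, smul_eq_mul]
              exact Nat.mul_le_mul_right _ ((Finset.card_le_card (Finset.filter_subset _ _)).trans hn)
      have h3 : 2^b < ∑ x ∈ U.filter (fun x => ¬ b+1 ≤ e x + t), 2^e x := by
        have : 2^b * 1 ≤ 2^b * s := Nat.mul_le_mul_left _ hs1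
        omega
      have h4 : 2^b * 2^t < (∑ x ∈ U.filter (fun x => ¬ b+1 ≤ e x + t), 2^e x) * 2^t :=
        Nat.mul_lt_mul_of_pos_right h3 (by positivity)
      have h5 : n * 2^b ≤ 2^t * 2^b := Nat.mul_le_mul_right _ ht
      rw [mul_comm (2^t)] at h5
      omega
    obtain ⟨P, hP, hPs⟩ := exact_subset e b (2^b*s) (Dvd.intro _ rfl) _ _ le_rfl
      (fun x hx => Nat.lt_succ_iff.mp (hN.1 x (Finset.mem_filter.mp hx).1)) hge
    exact ⟨P, hP, by rw [hPs, hs']⟩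
  have hM : (1:ℝ) ≤ (2*n+2)^t := one_le_pow₀ (by have : (0:ℝ) ≤ n := by positivity
                                                 linarith)
  induction q with
  | zero =>
    intro U hn B hN hc
    simp only [pow_zero, one_mul]
    exact key U hn B hN ((Finset.card_le_card (Finset.filter_subset _ _)).trans_lt (by simpa using hc))
  | succ q ih =>
    intro U hn B hN hc
    by_cases hV : (U.filter (fun x => B ≤ e x + t)).card < L
    · refine (key U hn B hN hV).trans ?_
      exact le_mul_of_one_le_left (Wt_nonneg _ _) (one_le_pow₀ hM)
    · push Not at hV
      obtain ⟨U', hU', hN', hW'⟩ := nice_steps e n t U hn B hN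
      have hsub : U' ⊆ U.filter (fun x => ¬ B ≤ e x + t) := by
        intro x hx
        have := hN'.1 x hx
        simp only [Finset.mem_filter]
        exact ⟨hU' hx, by omega⟩
      have hcard := Finset.card_filter_add_card_filter_not (s := U) (fun x => B ≤ e x + t)
      have hle := Finset.card_le_card hsub
      have hc' : U'.card < (q+1) * L := by
        have : (q+1+1)*L = (q+1)*L + L := by ring
        omega
      have := ih U' ((Finset.card_le_card hU').trans hn) _ hN' hc'
      refine this.trans ?_
      rw [pow_succ ((2*(n:ℝ)+2)^t), mul_assoc]
      gcongr

end comb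
end TQ

namespace TQ

theorem find_mem {α : Type} [DecidableEq α] : ∀ (T : DTree α) (x : α) (k : ℕ),
    T.find? x = some k → x ∈ T.leaves := by
  intro T
  induction T with
  | leaf y =>
    intro x k h
    simp only [DTree.find?] at h
    split_ifs at h with h1
    simp [DTree.leaves, h1]
  | node q t f iht ihf =>
    intro x k h
    simp only [DTree.find?, Option.map_eq_some_iff] at h
    obtain ⟨a, h, _⟩ := h
    simp only [DTree.leaves, List.mem_append]
    split_ifs at h with h1
    · exact Or.inl (iht x a h)
    · exact Or.inr (ihf x a h)

theorem kraft_tree {α : Type} [DecidableEq α] : ∀ (T : DTree α), T.leaves.Nodup →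
    (∀ x ∈ T.leaves, ∃ k, T.find? x = some k) →
    (T.leaves.map (fun x => (1/2:ℝ)^(T.depth x))).sum = 1 ∧
      ∀ x ∈ T.leaves, T.depth x + 1 ≤ T.leaves.length := by
  intro T
  induction T with
  | leaf y => intro _ _; simp [DTree.leaves, DTree.depth, DTree.find?]
  | node q t f iht ihf =>
    intro hnd hf
    simp only [DTree.leaves] at hnd hf ⊢
    rw [List.nodup_append] at hnd
    obtain ⟨hn1, hn2, hn3⟩ := hnd
    have ht : ∀ x ∈ t.leaves, ∃ k, t.find? x = some k ∧ (DTree.node q t f).find? x = some (k+1) := by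
      intro x hx
      obtain ⟨k, hk⟩ := hf x (List.mem_append_left _ hx)
      have hk' := hk
      simp only [DTree.find?, Option.map_eq_some_iff] at hk
      obtain ⟨a, h, rfl⟩ := hk
      split_ifs at h with h1
      · exact ⟨a, h, hk'⟩
      · exact absurd rfl (hn3 x hx x (find_mem _ _ _ h))
    have hff : ∀ x ∈ f.leaves, ∃ k, f.find? x = some k ∧ (DTree.node q t f).find? x = some (k+1) := by
      intro x hx
      obtain ⟨k, hk⟩ := hf x (List.mem_append_right _ hx)
      have hk' := hk
      simp only [DTree.find?, Option.map_eq_some_iff] at hk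
      obtain ⟨a, h, rfl⟩ := hk
      split_ifs at h with h1
      · exact absurd rfl (hn3 x (find_mem _ _ _ h) x hx)
      · exact ⟨a, h, hk'⟩
    obtain ⟨a1, a2⟩ := iht hn1 (fun x hx => (ht x hx).imp fun k h => h.1)
    obtain ⟨b1, b2⟩ := ihf hn2 (fun x hx => (hff x hx).imp fun k h => h.1)
    have ht' : ∀ x ∈ t.leaves, (DTree.node q t f).depth x = t.depth x + 1 := by
      intro x hx
      obtain ⟨k, h1, h2⟩ := ht x hx
      simp [DTree.depth, h1, h2]
    have hf' : ∀ x ∈ f.leaves, (DTree.node q t f).depth x = f.depth x + 1 := by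
      intro x hx
      obtain ⟨k, h1, h2⟩ := hff x hx
      simp [DTree.depth, h1, h2]
    have hl1 : 0 < t.leaves.length := by
      rcases h : t.leaves with _ | _
      · rw [h] at a1; simp at a1
      · simp
    have hl2 : 0 < f.leaves.length := by
      rcases h : f.leaves with _ | _
      · rw [h] at b1; simp at b1
      · simp
    constructor
    · rw [List.map_append, List.sum_append,
        List.map_congr_left (g := fun x => (1/2:ℝ)^(t.depth x) * (1/2))
          (fun x hx => by rw [ht' x hx, pow_succ]),
        List.map_congr_left (l := f.leaves) (g := fun x => (1/2:ℝ)^(f.depth x) * (1/2))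
          (fun x hx => by rw [hf' x hx, pow_succ]),
        List.sum_map_mul_right, List.sum_map_mul_right, a1, b1]
      norm_num
    · intro x hx
      rw [List.length_append]
      rcases List.mem_append.mp hx with h | h
      · rw [ht' x h]; have := a2 x h; omega
      · rw [hf' x h]; have := b2 x h; omega

theorem kraft_nat {n : ℕ} (U : Finset (Fin n)) (d : Fin n → ℕ) (hd : ∀ x ∈ U, d x ≤ n)
    (h : ∑ x ∈ U, (1/2:ℝ)^(d x) = 1) : ∑ x ∈ U, 2^(n - d x) = 2^n := by
  have : ((∑ x ∈ U, 2^(n - d x) : ℕ) : ℝ) = ((2^n : ℕ) : ℝ) := by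
    push_cast
    rw [← mul_one ((2:ℝ)^n), ← h, Finset.mul_sum]
    refine Finset.sum_congr rfl fun x hx => ?_
    rw [pow_sub₀ _ (by norm_num) (hd x hx)]
    simp
  exact_mod_cast this

theorem caterpillar {α : Type} [DecidableEq α] (U : Finset α) (hU : U.Nonempty) :
    ∃ T : DTree α, T.leaves.Nodup ∧ (∀ x, x ∈ T.leaves ↔ x ∈ U) ∧
      ∀ x ∈ U, ∃ k, T.find? x = some k := by
  induction hU using Finset.Nonempty.cons_induction with
  | singleton a => exact ⟨.leaf a, by simp [DTree.leaves], by simp [DTree.leaves],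
      by simp [DTree.find?]⟩
  | cons a s ha hs ih =>
    obtain ⟨T, h1, h2, h3⟩ := ih
    refine ⟨.node {a} (.leaf a) T, ?_, ?_, ?_⟩
    · simp [DTree.leaves, h1, h2, ha]
    · intro x; simp [DTree.leaves, h2]
    · intro x hx
      simp only [Finset.mem_cons] at hx
      by_cases hxa : x = a
      · subst hxa; simp [DTree.find?]
      · obtain ⟨k, hk⟩ := h3 x (hx.resolve_left hxa)
        exact ⟨k+1, by simp [DTree.find?, hxa, hk]⟩

theorem kraft_pos {n : ℕ} (U : Finset (Fin n)) (d : Fin n → ℕ) 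
    (h2 : 2 ≤ U.card) (hk : ∑ x ∈ U, 2^(n - d x) = 2^n) : ∀ x ∈ U, 1 ≤ d x := by
  intro x hx
  by_contra h0
  have h0 : d x = 0 := by omega
  have h3 := Finset.add_sum_erase U (fun y => 2^(n - d y)) hx
  simp only [hk, h0, Nat.sub_zero] at h3
  have : 0 < ∑ y ∈ U.erase x, 2^(n - d y) := Finset.sum_pos (fun _ _ => by positivity) (by
    rw [← Finset.card_pos, Finset.card_erase_of_mem hx]; omega)
  omega

theorem build {n : ℕ} (Q : Finset (Finset (Fin n)))
    (hQ : ∀ (U : Finset (Fin n)) (d : Fin n → ℕ), (∀ x, d x ≤ n) → 2 ≤ U.card →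
      ∑ x ∈ U, 2^(n - d x) = 2^n →
      ∃ q ∈ Q, q ⊆ U ∧ 2 * ∑ x ∈ q, 2^(n - d x) = ∑ x ∈ U, 2^(n - d x)) :
    ∀ (c : ℕ) (U : Finset (Fin n)) (d : Fin n → ℕ), U.card ≤ c → U.Nonempty → (∀ x, d x ≤ n) →
      ∑ x ∈ U, 2^(n - d x) = 2^n →
      ∃ T : DTree (Fin n), T.leaves.Nodup ∧ (∀ x, x ∈ T.leaves ↔ x ∈ U) ∧
        (∀ x ∈ U, T.find? x = some (d x)) ∧ T.questions ⊆ (Q : Set (Finset (Fin n))) := by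
  intro c
  induction c with
  | zero => intro U d hc hne; rw [← Finset.card_pos] at hne; omega
  | succ c ih =>
    intro U d hc hne hd hk
    by_cases h2 : 2 ≤ U.card
    · obtain ⟨q, hq, hqU, hqs⟩ := hQ U d hd h2 hk
      have hpos := kraft_pos U d h2 hk
      have hsd := Finset.sum_sdiff (f := fun x => 2^(n - d x)) hqU
      have hn2 : 0 < 2^n := by positivity
      have hshift : ∀ V ⊆ U, ∑ x ∈ V, 2^(n - (d x - 1)) = 2 * ∑ x ∈ V, 2^(n - d x) := by
        intro V hV
        rw [Finset.mul_sum]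
        refine Finset.sum_congr rfl fun x hx => ?_
        have := hpos x (hV hx)
        have := hd x
        rw [← pow_succ']; congr 1; omega
      have hqne : q.Nonempty := by
        rw [Finset.nonempty_iff_ne_empty]; rintro rfl; simp at hqs; omega
      have hrne : (U \ q).Nonempty := by
        rw [Finset.nonempty_iff_ne_empty]; intro h; rw [h] at hsd; simp at hsd; omega
      have hcs := Finset.card_sdiff_add_card_eq_card hqU
      have hq1 := Finset.card_pos.mpr hqne
      have hr1 := Finset.card_pos.mpr hrne
      have hd' : ∀ x, d x - 1 ≤ n := fun x => by have := hd x; omega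
      obtain ⟨T1, a1, a2, a3, a4⟩ := ih q (fun x => d x - 1) (by omega) hqne hd'
        (by rw [hshift q hqU]; omega)
      obtain ⟨T2, b1, b2, b3, b4⟩ := ih (U \ q) (fun x => d x - 1) (by omega) hrne hd'
        (by rw [hshift _ Finset.sdiff_subset]; omega)
      refine ⟨.node q T1 T2, ?_, ?_, ?_, ?_⟩
      · simp only [DTree.leaves]
        rw [List.nodup_append]
        refine ⟨a1, b1, ?_⟩
        rintro x hx y hy rfl
        rw [a2] at hx; rw [b2] at hy
        exact (Finset.mem_sdiff.mp hy).2 hx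
      · intro x
        simp only [DTree.leaves, List.mem_append, a2, b2, Finset.mem_sdiff]
        constructor
        · rintro (h | h)
          · exact hqU h
          · exact h.1
        · intro h; by_cases hx : x ∈ q
          · exact Or.inl hx
          · exact Or.inr ⟨h, hx⟩
      · intro x hx
        have h1 := hpos x hx
        simp only [DTree.find?]
        by_cases hxq : x ∈ q
        · simp only [hxq, if_true, a3 x hxq, Option.map_some]; congr 1; omega
        · simp only [hxq, if_false, b3 x (Finset.mem_sdiff.mpr ⟨hx, hxq⟩), Option.map_some]
          congr 1; omega
      · simp only [DTree.questions]
        rw [Set.insert_subset_iff]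
        exact ⟨hq, Set.union_subset a4 b4⟩
    · have : U.card = 1 := by rw [← Finset.card_pos] at hne; omega
      obtain ⟨a, rfl⟩ := Finset.card_eq_one.mp this
      refine ⟨.leaf a, by simp [DTree.leaves], by simp [DTree.leaves], ?_, by simp [DTree.questions]⟩
      intro x hx
      rw [Finset.mem_singleton] at hx; subst hx
      simp only [Finset.sum_singleton] at hk
      have := Nat.pow_right_injective le_rfl hk
      have := hd x
      simp only [DTree.find?, if_true]
      congr 1; omega

/-- Any valid tree gives a bounded Kraft function. -/
theorem kraft_valid {n : ℕ} (U : Finset (Fin n)) (T : DTree (Fin n)) (h1 : T.leaves.Nodup)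
    (h2 : ∀ x, x ∈ T.leaves ↔ x ∈ U) (h3 : ∀ x ∈ U, ∃ k, T.find? x = some k) :
    (∀ x ∈ U, T.depth x ≤ n) ∧ ∑ x ∈ U, 2^(n - T.depth x) = 2^n := by
  obtain ⟨a, b⟩ := kraft_tree T h1 (fun x hx => h3 x ((h2 x).mp hx))
  have hlen : T.leaves.length ≤ n := by simpa using h1.length_le_card
  have hb : ∀ x ∈ U, T.depth x ≤ n := fun x hx => by
    have := b x ((h2 x).mpr hx); omega
  refine ⟨hb, kraft_nat U _ hb ?_⟩
  have hU : U = T.leaves.toFinset := by ext x; simp [h2]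
  rw [hU, List.sum_toFinset _ h1, a]

theorem achieves {n : ℕ} (Q : Finset (Finset (Fin n)))
    (hQ : ∀ (U : Finset (Fin n)) (d : Fin n → ℕ), (∀ x, d x ≤ n) → 2 ≤ U.card →
      ∑ x ∈ U, 2^(n - d x) = 2^n →
      ∃ q ∈ Q, q ⊆ U ∧ 2 * ∑ x ∈ q, 2^(n - d x) = ∑ x ∈ U, 2^(n - d x)) :
    AchievesProlixity Q 0 := by
  classical
  intro μ hμ
  set U : Finset (Fin n) := Finset.univ.filter (fun x => μ x ≠ 0) with hU
  have hmem : ∀ x, x ∈ U ↔ μ x ≠ 0 := by simp [hU]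
  have hne : U.Nonempty := by
    rw [Finset.nonempty_iff_ne_empty]
    intro h
    have : ∀ x, μ x = 0 := by
      intro x; by_contra hx
      have := (hmem x).mpr hx
      rw [h] at this; simp at this
    have h2 := hμ.2
    simp [this] at h2
  set K : Finset (Fin n → Fin (n+1)) :=
    Finset.univ.filter (fun d => ∑ x ∈ U, 2^(n - (d x : ℕ)) = 2^n) with hK
  have hTK : ∀ T : DTree (Fin n), T.leaves.Nodup → (∀ x, x ∈ T.leaves ↔ x ∈ U) →
      (∀ x ∈ U, ∃ k, T.find? x = some k) → ∃ d ∈ K, ∀ x ∈ U, (d x : ℕ) = T.depth x := by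
    intro T h1 h2 h3
    obtain ⟨a, b⟩ := kraft_valid U T h1 h2 h3
    have hv : ∀ x ∈ U, ((Fin.ofNat (n+1) (T.depth x) : Fin (n+1)) : ℕ) = T.depth x := by
      intro x hx
      have := a x hx
      simp only [Fin.val_ofNat]
      exact Nat.mod_eq_of_lt (by omega)
    refine ⟨fun x => Fin.ofNat (n+1) (T.depth x), ?_, hv⟩
    simp only [hK, Finset.mem_filter, Finset.mem_univ, true_and]
    rw [← b]
    exact Finset.sum_congr rfl fun x hx => by rw [hv x hx]
  obtain ⟨T0, c1, c2, c3⟩ := caterpillar U hne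
  have hKne : K.Nonempty := by
    obtain ⟨d, hd, _⟩ := hTK T0 c1 c2 c3
    exact ⟨d, hd⟩
  obtain ⟨d, hd, hmin⟩ := Finset.exists_min_image K
    (fun d => ∑ x, μ x * ((d x : ℕ) : ℝ)) hKne
  have hd2 : ∑ x ∈ U, 2^(n - (d x : ℕ)) = 2^n := by simpa [hK] using hd
  obtain ⟨T, t1, t2, t3, t4⟩ := build Q hQ U.card U (fun x => (d x : ℕ)) le_rfl hne
    (fun x => Nat.lt_succ_iff.mp (d x).2) hd2
  have hdep : ∀ x ∈ U, T.depth x = d x := fun x hx => by simp [DTree.depth, t3 x hx]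
  have hval : IsValid T μ := ⟨t1, fun x => by rw [t2, hmem], fun x hx => by
    rw [hdep x ((hmem x).mpr hx)]; exact t3 x ((hmem x).mpr hx)⟩
  have hcost : ∀ (T : DTree (Fin n)) (d : Fin n → Fin (n+1)), (∀ x ∈ U, (d x : ℕ) = T.depth x) →
      cost T μ = ∑ x, μ x * ((d x : ℕ) : ℝ) := by
    intro T d h
    unfold cost
    refine Finset.sum_congr rfl fun x _ => ?_
    by_cases hx : μ x = 0
    · simp [hx]
    · rw [h x ((hmem x).mpr hx)]
  refine ⟨T, hval, t4, ?_⟩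
  rw [add_zero]
  unfold OptCost
  refine le_csInf ?_ ?_
  · exact ⟨cost T μ, T, hval, rfl⟩
  rintro c ⟨T', hT', rfl⟩
  obtain ⟨d', hd', hdd⟩ := hTK T' hT'.nodup (fun x => by rw [hT'.mem_leaves, hmem])
    (fun x hx => ⟨_, hT'.finds x ((hmem x).mp hx)⟩)
  rw [hcost T d (fun x hx => (hdep x hx).symm), hcost T' d' hdd]
  exact hmin d' hd'

end TQ

namespace TQ

theorem hitting {ι Ω : Type} [Fintype Ω] [Nonempty Ω] [DecidableEq Ω] [DecidableEq ι]
    (p : Ω → ℝ) (hp : ∀ ω, 0 < p ω)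
    (I : Finset ι) (F : ι → Finset Ω) (ρ : ℝ) (hρ : ρ ≤ 1)
    (hF : ∀ i ∈ I, ρ * ∑ ω, p ω ≤ ∑ ω ∈ F i, p ω) (k : ℕ) :
    ∃ Q : Finset Ω, Q.card ≤ k ∧
      ((I.filter (fun i => Disjoint (F i) Q)).card : ℝ) ≤ I.card * (1-ρ)^k := by
  induction k with
  | zero =>
    refine ⟨∅, by simp, ?_⟩
    simp
  | succ k ih =>
    obtain ⟨Q, hQ, hb⟩ := ih
    set J := I.filter (fun i => Disjoint (F i) Q) with hJ
    have hex : ∃ ω ∈ (Finset.univ : Finset Ω), p ω * (ρ * J.card) ≤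
        p ω * ((J.filter (fun i => ω ∈ F i)).card : ℝ) := by
      apply Finset.exists_le_of_sum_le Finset.univ_nonempty
      calc _ = ∑ i ∈ J, ρ * ∑ ω, p ω := by
            rw [← Finset.sum_mul, Finset.sum_const, nsmul_eq_mul]; ring
        _ ≤ ∑ i ∈ J, ∑ ω ∈ F i, p ω :=
            Finset.sum_le_sum fun i hi => hF i (Finset.mem_filter.mp hi).1
        _ = ∑ i ∈ J, ∑ ω, if ω ∈ F i then p ω else 0 := by
            refine Finset.sum_congr rfl fun i _ => ?_
            rw [← Finset.sum_filter]; congr 1; ext ω; simp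
        _ = ∑ ω, ∑ i ∈ J, if ω ∈ F i then p ω else 0 := Finset.sum_comm
        _ = _ := by
            refine Finset.sum_congr rfl fun ω _ => ?_
            rw [← Finset.sum_filter, Finset.sum_const, nsmul_eq_mul, mul_comm]
    obtain ⟨ω, -, hω⟩ := hex
    have hω' := le_of_mul_le_mul_left hω (hp ω)
    refine ⟨insert ω Q, (Finset.card_insert_le _ _).trans (by omega), ?_⟩
    have hsub : I.filter (fun i => Disjoint (F i) (insert ω Q)) ⊆
        J.filter (fun i => ¬ ω ∈ F i) := by
      intro i hi
      simp only [hJ, Finset.mem_filter, Finset.disjoint_insert_right] at hi ⊢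
      tauto
    have hc := Finset.card_filter_add_card_filter_not (s := J) (fun i => ω ∈ F i)
    have hc' : ((J.filter (fun i => ω ∈ F i)).card : ℝ) +
      ((J.filter (fun i => ¬ ω ∈ F i)).card : ℝ) = J.card := by exact_mod_cast hc
    have hle : ((I.filter (fun i => Disjoint (F i) (insert ω Q))).card : ℝ) ≤
        (J.filter (fun i => ¬ ω ∈ F i)).card := by exact_mod_cast Finset.card_le_card hsub
    rw [pow_succ, ← mul_assoc]
    have : (J.card : ℝ) * (1-ρ) ≤ I.card * (1-ρ)^k * (1-ρ) :=
      mul_le_mul_of_nonneg_right hb (by linarith)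
    linarith

theorem uOpt_bound (n t L q : ℕ) (ht : n ≤ 2^t) (hq : n < (q+1) * L) :
    (uOpt n 0 : ℝ) ≤ (2*n+2)^2 * ((5/4)^n * (4^L * ((2*n+2)^t)^q)) := by
  set M : ℝ := 2*n+2 with hM
  have hn0 : (0:ℝ) ≤ n := by positivity
  have hM2 : 2 ≤ M := by linarith
  set A : ℝ := (5/4)^n * (4^L * (M^t)^q) with hA
  have hA1 : 1 ≤ A := by
    have h1 : (1:ℝ) ≤ (5/4)^n := one_le_pow₀ (by norm_num)
    have h2 : (1:ℝ) ≤ 4^L := one_le_pow₀ (by norm_num)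
    have h3 : (1:ℝ) ≤ (M^t)^q := one_le_pow₀ (one_le_pow₀ (by linarith))
    exact one_le_mul_of_one_le_of_one_le h1 (one_le_mul_of_one_le_of_one_le h2 h3)
  have hApos : 0 < A := by linarith
  let e : (Fin n → Fin (n+1)) → Fin n → ℕ := fun d x => 2^(n - (d x : ℕ))
  let I : Finset (Finset (Fin n) × (Fin n → Fin (n+1))) :=
    Finset.univ.filter (fun i => 2 ≤ i.1.card ∧ ∑ x ∈ i.1, 2^(n - (i.2 x : ℕ)) = 2^n)
  let F : Finset (Fin n) × (Fin n → Fin (n+1)) → Finset (Finset (Fin n)) :=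
    fun i => Spl (fun x => 2^(n - (i.2 x : ℕ))) i.1
  have htot : ∑ S : Finset (Fin n), (1/4:ℝ)^S.card = (5/4)^n := by
    have := Fintype.sum_pow_mul_eq_add_pow (Fin n) (1/4:ℝ) 1
    simp only [one_pow, mul_one, Fintype.card_fin] at this
    rw [this]; norm_num
  have hF : ∀ i ∈ I, A⁻¹ * ∑ S : Finset (Fin n), (1/4:ℝ)^S.card ≤
      ∑ S ∈ F i, (1/4:ℝ)^S.card := by
    rintro ⟨U, d⟩ hi
    simp only [I, Finset.mem_filter, Finset.mem_univ, true_and] at hi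
    have hpos := kraft_pos U (fun x => (d x : ℕ)) hi.1 hi.2
    have hUn : U.card ≤ n := by simpa using Finset.card_le_univ U
    have hN : Nice (fun x => n - (d x : ℕ)) U n := by
      refine ⟨fun x hx => ?_, by rw [hi.2]⟩
      have := hpos x hx
      simp only at this ⊢
      omega
    have hW := Wt_main (fun x => n - (d x : ℕ)) n t L ht q U hUn n hN (by omega)
    rw [← hM] at hW
    change _ ≤ Wt (fun x => 2^(n - (d x : ℕ))) U
    rw [htot]
    have h5 : (0:ℝ) < (5/4)^n := by positivity
    rw [inv_mul_le_iff₀ hApos, hA, mul_assoc]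
    refine le_mul_of_one_le_right h5.le ?_
    have h4 : (1:ℝ) = 4^L * (1/4:ℝ)^L := by rw [← mul_pow]; norm_num
    refine h4.le.trans ?_
    rw [mul_assoc]
    gcongr
  have hIc : (I.card : ℝ) ≤ M^n := by
    have h1 : I.card ≤ (2*n+2)^n := by
      refine (Finset.card_le_univ I).trans ?_
      simp only [Fintype.card_prod, Fintype.card_finset, Fintype.card_fin, Fintype.card_fun]
      rw [← mul_pow]
      exact le_of_eq (by ring)
    rw [hM]; exact_mod_cast h1
  obtain ⟨k, hk1, hk2⟩ : ∃ k : ℕ, A * (n * Real.log M) < k ∧ (k:ℝ) ≤ A * (n * Real.log M) + 1 := by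
    refine ⟨⌊A * (n * Real.log M)⌋₊ + 1, ?_, ?_⟩
    · push_cast; exact Nat.lt_floor_add_one _
    · push_cast
      have : 0 ≤ A * (n * Real.log M) := by
        have := Real.log_nonneg (by linarith : 1 ≤ M)
        positivity
      linarith [Nat.floor_le this]
  obtain ⟨Q, hQc, hQ⟩ := hitting (fun S : Finset (Fin n) => (1/4:ℝ)^S.card)
    (fun _ => by positivity) I F A⁻¹ (inv_le_one_of_one_le₀ hA1) hF k
  have hlt : (I.card : ℝ) * (1 - A⁻¹)^k < 1 := by
    have h0 : 0 ≤ 1 - A⁻¹ := by linarith [inv_le_one_of_one_le₀ hA1]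
    have h1 : (1 - A⁻¹)^k ≤ Real.exp (-(k * A⁻¹)) := by
      have : 1 - A⁻¹ ≤ Real.exp (-A⁻¹) := by linarith [Real.add_one_le_exp (-A⁻¹)]
      calc _ ≤ (Real.exp (-A⁻¹))^k := pow_le_pow_left₀ h0 this k
        _ = _ := by rw [← Real.exp_nat_mul]; congr 1; ring
    have h2 : M^n = Real.exp (n * Real.log M) := by
      rw [Real.exp_nat_mul, Real.exp_log (by linarith)]
    calc _ ≤ M^n * Real.exp (-(k * A⁻¹)) := by gcongr
      _ = Real.exp (n * Real.log M - k * A⁻¹) := by rw [h2, ← Real.exp_add]; congr 1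
      _ < 1 := by
        rw [Real.exp_lt_one_iff]
        have : n * Real.log M < k * A⁻¹ := by
          rw [← div_eq_mul_inv, lt_div_iff₀ hApos]; linarith
        linarith
  have hempty : I.filter (fun i => Disjoint (F i) Q) = ∅ := by
    rw [← Finset.card_eq_zero]
    have : ((I.filter (fun i => Disjoint (F i) Q)).card : ℝ) < 1 := lt_of_le_of_lt hQ hlt
    have : (I.filter (fun i => Disjoint (F i) Q)).card < 1 := by exact_mod_cast this
    omega
  have hach : AchievesProlixity Q 0 := by
    apply achieves
    intro U d hd h2 hk
    have hmemI : (U, (fun x => ⟨d x, Nat.lt_succ_iff.mpr (hd x)⟩ : Fin n → Fin (n+1))) ∈ I := by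
      simp only [I, Finset.mem_filter, Finset.mem_univ, true_and]
      exact ⟨h2, hk⟩
    have hnd : ¬ Disjoint (F (U, (fun x => ⟨d x, Nat.lt_succ_iff.mpr (hd x)⟩ : Fin n → Fin (n+1)))) Q := by
      intro hdis
      have := (Finset.mem_filter (p := fun i => Disjoint (F i) Q)).mpr ⟨hmemI, hdis⟩
      rw [hempty] at this
      simp at this
    rw [Finset.not_disjoint_iff] at hnd
    obtain ⟨S, hS1, hS2⟩ := hnd
    simp only [F, Spl, Finset.mem_filter, Finset.mem_powerset] at hS1
    exact ⟨S, hS2, hS1.1, hS1.2⟩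
  have hu : uOpt n 0 ≤ Q.card := Nat.sInf_le ⟨Q, rfl, hach⟩
  have hu' : (uOpt n 0 : ℝ) ≤ k := by exact_mod_cast hu.trans hQc
  have hlog : Real.log M ≤ M := (Real.log_le_sub_one_of_pos (by linarith)).trans (by linarith)
  calc (uOpt n 0 : ℝ) ≤ A * (n * Real.log M) + 1 := hu'.trans hk2
    _ ≤ A * (n * M) + A * 1 := by gcongr; linarith
    _ = (n * M + 1) * A := by ring
    _ ≤ M^2 * A := by gcongr; nlinarith

theorem asym (η : ℝ) (hη : 0 < η) : ∃ N : ℕ, ∀ n : ℕ, N ≤ n →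
    10 * (√(2*n+2) * (Real.log (2*n+2))^2) ≤ η * n := by
  have h1 := isLittleO_log_rpow_rpow_atTop (s := 1/2) 2 (by norm_num)
  have h2 := h1.bound (show (0:ℝ) < η/40 by positivity)
  have hT : Filter.Tendsto (fun n : ℕ => 2*(n:ℝ)+2) Filter.atTop Filter.atTop :=
    Filter.tendsto_atTop_add_const_right _ _
      (Filter.Tendsto.const_mul_atTop (by norm_num) tendsto_natCast_atTop_atTop)
  have h3 := (hT.eventually h2).and (Filter.eventually_ge_atTop 1)
  obtain ⟨N, hN⟩ := Filter.eventually_atTop.mp h3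
  refine ⟨N, fun n hn => ?_⟩
  obtain ⟨h, hn1⟩ := hN n hn
  have hn1' : (1:ℝ) ≤ n := by exact_mod_cast hn1
  have hx : (0:ℝ) ≤ 2*n+2 := by positivity
  rw [Real.rpow_two, Real.norm_of_nonneg (by positivity), Real.norm_of_nonneg (by positivity),
    ← Real.sqrt_eq_rpow] at h
  calc 10 * (√(2*n+2) * (Real.log (2*n+2))^2) ≤ 10 * (√(2*n+2) * (η/40 * √(2*n+2))) := by gcongr
    _ = η/4 * (√(2*n+2) * √(2*n+2)) := by ring
    _ = η/4 * (2*n+2) := by rw [Real.mul_self_sqrt hx]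
    _ ≤ η * n := by nlinarith

theorem final_bound (n : ℕ) (hn : 1 ≤ n) :
    (uOpt n 0 : ℝ) ≤ (5/4)^n * Real.exp (10 * (√(2*n+2) * (Real.log (2*n+2))^2)) := by
  have hb := uOpt_bound n (Nat.log 2 n + 1) (Nat.sqrt n + 1) (Nat.sqrt n)
    (Nat.lt_pow_succ_log_self (by norm_num) n).le (Nat.lt_succ_sqrt n)
  refine hb.trans ?_
  have hn1' : (1:ℝ) ≤ n := by exact_mod_cast hn
  set M : ℝ := 2*n+2 with hM
  have hM4 : 4 ≤ M := by linarith
  have hMpos : 0 < M := by linarith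
  set l := Real.log M with hl
  have hl4 : Real.log 4 ≤ l := Real.log_le_log (by norm_num) hM4
  have hlog2 := Real.log_two_gt_d9
  have h42 : Real.log 4 = 2 * Real.log 2 := by
    rw [show (4:ℝ) = 2^2 by norm_num, Real.log_pow]; norm_num
  have hl1 : 1 ≤ l := by linarith
  have hs : (Nat.sqrt n : ℝ) ≤ √M := by
    apply Real.le_sqrt_of_sq_le
    have : ((Nat.sqrt n)^2 : ℝ) ≤ n := by exact_mod_cast Nat.sqrt_le' n
    linarith
  have hr1 : 1 ≤ √M := by rw [Real.one_le_sqrt]; linarith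
  set r := √M with hr
  have ht : (Nat.log 2 n : ℝ) ≤ 2 * l := by
    have h1 : (2:ℝ)^(Nat.log 2 n) ≤ M := by
      have : 2^(Nat.log 2 n) ≤ n := Nat.pow_log_le_self 2 (by omega)
      have : (2:ℝ)^(Nat.log 2 n) ≤ n := by exact_mod_cast this
      linarith
    have h2 := Real.log_le_log (by positivity) h1
    rw [Real.log_pow, ← hl] at h2
    have : (0:ℝ) ≤ Nat.log 2 n := by positivity
    nlinarith
  have hMe : M = Real.exp l := (Real.exp_log hMpos).symm
  have h4e : (4:ℝ) ≤ Real.exp l := by rw [← hMe]; exact hM4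
  have e1 : M^2 = Real.exp (2 * l) := by
    rw [hMe, ← Real.exp_nat_mul]; norm_num
  have e2 : (4:ℝ)^(Nat.sqrt n + 1) ≤ Real.exp ((Nat.sqrt n + 1) * l) := by
    calc _ ≤ (Real.exp l)^(Nat.sqrt n + 1) := by gcongr
      _ = _ := by rw [← Real.exp_nat_mul]; push_cast; rfl
  have e3 : (M^(Nat.log 2 n + 1))^(Nat.sqrt n) = Real.exp ((Nat.log 2 n + 1) * Nat.sqrt n * l) := by
    rw [← pow_mul, hMe, ← Real.exp_nat_mul]; push_cast; rfl
  calc M^2 * ((5/4)^n * (4^(Nat.sqrt n + 1) * (M^(Nat.log 2 n + 1))^(Nat.sqrt n)))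
      = (5/4)^n * (M^2 * 4^(Nat.sqrt n + 1) * (M^(Nat.log 2 n + 1))^(Nat.sqrt n)) := by ring
    _ ≤ (5/4)^n * (Real.exp (2*l) * Real.exp ((Nat.sqrt n + 1) * l) *
        Real.exp ((Nat.log 2 n + 1) * Nat.sqrt n * l)) := by
          rw [e1, e3]; gcongr
    _ ≤ _ := by
      rw [← Real.exp_add, ← Real.exp_add]
      gcongr
      have hrl : l ≤ r * l^2 := by nlinarith [mul_nonneg (sub_nonneg.mpr hr1) (sub_nonneg.mpr hl1)]
      have hrl2 : r * l ≤ r * l^2 := by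
        have : l ≤ l^2 := by nlinarith
        gcongr
      have a1 : (Nat.sqrt n : ℝ) * l ≤ r * l := by gcongr
      have a2 : ((Nat.log 2 n : ℝ) + 1) * Nat.sqrt n * l ≤ (3*l) * r * l := by
        gcongr; linarith
      nlinarith

end TQ

open TQ in
/-- `u_Opt(n,0) ≤ 1.25^{n+o(n)}`: for every `δ > 0`, eventually `u_Opt(n,0) ≤ (1.25+δ)^n`. -/
theorem uOpt_zero_upper (δ : ℝ) (hδ : 0 < δ) :
    ∃ N : ℕ, ∀ n : ℕ, N ≤ n → (uOpt n 0 : ℝ) ≤ (1.25 + δ) ^ n := by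
  have h1 : 1 < 1 + 4/5*δ := by linarith
  obtain ⟨N, hN⟩ := asym (Real.log (1 + 4/5*δ)) (Real.log_pos h1)
  refine ⟨N + 1, fun n hn => ?_⟩
  refine (final_bound n (by omega)).trans ?_
  calc _ ≤ (5/4:ℝ)^n * Real.exp (Real.log (1 + 4/5*δ) * n) := by
        exact mul_le_mul_of_nonneg_left (Real.exp_le_exp.mpr (hN n (by omega))) (by positivity)
    _ = (5/4:ℝ)^n * (1 + 4/5*δ)^n := by
        rw [mul_comm (Real.log _), Real.exp_nat_mul, Real.exp_log (by linarith)]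
    _ = (1.25 + δ)^n := by rw [← mul_pow]; congr 1; ring
end
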